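/- The Radon transform ℛ is a topological isomorphism of the Schwartz space 𝒮(ℝⁿ) onto 𝒮_H(Ξ), i.e. it is a continuous linear bijection with continuous inverse (n ≥ 2). -/

import Mathlib

open MeasureTheory Real Complex Finset

noncomputable section

variable {n : ℕ}

/-- The Radon transform, extended to a degree-zero homogeneous function of the normal
vector: for `x ≠ 0`, `RadonH f p x` is the integral of `f` over the hyperplane with unit
normal `x/‖x‖` at signed distance `p` from the origin, with respect to Lebesgue measure
on the hyperplane (realized as `(n-1)`-dimensional Hausdorff measure). -/
def RadonH (f : EuclideanSpace ℝ (Fin n) → ℂ)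
    (q : ℝ × EuclideanSpace ℝ (Fin n)) : ℂ :=
  ∫ x in {x : EuclideanSpace ℝ (Fin n) | ∑ i, x i * q.2 i = q.1 * ‖q.2‖},
    f x ∂(μH[((n : ℝ) - 1)])

/-- Functions on `ℝ × S^{n-1}`, identified with degree-zero homogeneous (in the second
variable) functions on `ℝ × (ℝⁿ ∖ {0})`. -/
def IsHomog0 (φ : ℝ × EuclideanSpace ℝ (Fin n) → ℂ) : Prop :=
  ∀ (r t : ℝ) (x : EuclideanSpace ℝ (Fin n)), 0 < t → φ (r, t • x) = φ (r, x)

/-- The seminorms `η_{k,m}` of `𝒮_H(Ξ)`: taking the full iterated derivative of order `m`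
(on `ℝ × (ℝⁿ∖{0})`) encodes all products of `∂_r`-derivatives and differential operators
on the sphere. -/
def etaSemi (k m : ℕ) (φ : ℝ × EuclideanSpace ℝ (Fin n) → ℂ) : ℝ :=
  ⨆ (r : ℝ), ⨆ (ω : EuclideanSpace ℝ (Fin n)), ⨆ (_ : ‖ω‖ = 1),
    (1 + r ^ 2) ^ k *
      ‖iteratedFDerivWithin ℝ m φ
        (Set.univ ×ˢ {x : EuclideanSpace ℝ (Fin n) | x ≠ 0}) (r, ω)‖

/-- Membership in `𝒮_H(Ξ)`: even, smooth, all seminorms `η_{k,m}` finite, and the `k`-th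
moment in `r` is (the restriction to the sphere of) a homogeneous polynomial of degree
`k` in `ω`. -/
def IsSH (φ : ℝ × EuclideanSpace ℝ (Fin n) → ℂ) : Prop :=
  IsHomog0 φ ∧
  (∀ (r : ℝ) (x : EuclideanSpace ℝ (Fin n)), φ (-r, -x) = φ (r, x)) ∧
  ContDiffOn ℝ (⊤ : ℕ∞) φ (Set.univ ×ˢ {x : EuclideanSpace ℝ (Fin n) | x ≠ 0}) ∧
  (∀ k m : ℕ, ∃ C : ℝ, ∀ (r : ℝ) (ω : EuclideanSpace ℝ (Fin n)), ‖ω‖ = 1 →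
    (1 + r ^ 2) ^ k *
      ‖iteratedFDerivWithin ℝ m φ
        (Set.univ ×ˢ {x : EuclideanSpace ℝ (Fin n) | x ≠ 0}) (r, ω)‖ ≤ C) ∧
  (∀ k : ℕ, ∃ P : MvPolynomial (Fin n) ℂ, P.IsHomogeneous k ∧
    ∀ ω : EuclideanSpace ℝ (Fin n), ‖ω‖ = 1 →
      (∫ r : ℝ, φ (r, ω) * (r : ℂ) ^ k) = MvPolynomial.eval (fun i => (ω i : ℂ)) P)

open scoped SchwartzMap Topology FourierTransform

/-- The exponential kernel of the one-dimensional inverse Fourier transform. -/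
def waveKernel (s p : ℝ) : ℂ := cexp (2 * π * I * (s * p))

lemma norm_waveKernel (s p : ℝ) : ‖waveKernel s p‖ = 1 := by
  have h : (2 * π * I * (s * p) : ℂ) = ((2 * π * (s * p) : ℝ) : ℂ) * I := by
    push_cast; ring
  rw [waveKernel, h, Complex.norm_exp_ofReal_mul_I]

lemma continuous_waveKernel : Continuous fun q : ℝ × ℝ => waveKernel q.1 q.2 := by
  unfold waveKernel
  fun_prop

lemma hasDerivAt_waveKernel_left (s p : ℝ) :
    HasDerivAt (fun s => waveKernel s p) (2 * π * I * p * waveKernel s p) s := by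
  have h : HasDerivAt (fun s : ℝ => (2 * π * I * ((s : ℂ) * p) : ℂ)) (2 * π * I * p) s := by
    have := (((hasDerivAt_id (s : ℂ)).comp_ofReal).mul_const (p : ℂ)).const_mul (2 * π * I : ℂ)
    simpa using this
  have := h.cexp
  simpa [waveKernel, mul_comm] using this

lemma waveKernel_comm (s p : ℝ) : waveKernel s p = waveKernel p s := by
  simp [waveKernel, mul_comm]

section Punctured

variable {E : Type} [NormedAddCommGroup E]

/-- The set of pairs `(r, ξ)` with `ξ ≠ 0`. -/
def punctured (E : Type) [NormedAddCommGroup E] : Set (ℝ × E) :=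
  Set.univ ×ˢ {x : E | x ≠ 0}

lemma isOpen_punctured : IsOpen (punctured E) := isOpen_univ.prod isOpen_ne

lemma mem_punctured {q : ℝ × E} : q ∈ punctured E ↔ q.2 ≠ 0 := by simp [punctured]

lemma mem_punctured_of_norm_eq_one {p : ℝ} {ω : E} (hω : ‖ω‖ = 1) : (p, ω) ∈ punctured E :=
  mem_punctured.2 (by rw [← norm_pos_iff]; simp [hω])

end Punctured

section Forward

variable {E : Type} [NormedAddCommGroup E] [NormedSpace ℝ E]

/-- The double sum of Schwartz seminorms up to given orders. -/
def schwartzSum {V : Type} [NormedAddCommGroup V] [NormedSpace ℝ V] (K M : ℕ) (F : 𝓢(E, V)) : ℝ :=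
  ∑ k ∈ range (K + 1), ∑ m ∈ range (M + 1), SchwartzMap.seminorm ℝ k m F

section SchwartzSum

variable {V : Type} [NormedAddCommGroup V] [NormedSpace ℝ V]

lemma schwartzSum_nonneg (K M : ℕ) (F : 𝓢(E, V)) : 0 ≤ schwartzSum K M F :=
  sum_nonneg fun _ _ => sum_nonneg fun _ _ => apply_nonneg _ _

lemma schwartzSum_mono {K K' M M' : ℕ} (hK : K ≤ K') (hM : M ≤ M') (F : 𝓢(E, V)) :
    schwartzSum K M F ≤ schwartzSum K' M' F := by
  unfold schwartzSum
  have hM' : range (M + 1) ⊆ range (M' + 1) := range_mono (by omega)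
  have hK' : range (K + 1) ⊆ range (K' + 1) := range_mono (by omega)
  refine (sum_le_sum fun k _ => sum_le_sum_of_subset_of_nonneg hM'
    fun _ _ _ => apply_nonneg _ _).trans ?_
  exact sum_le_sum_of_subset_of_nonneg hK' fun _ _ _ => sum_nonneg fun _ _ => apply_nonneg _ _

lemma seminorm_le_schwartzSum {k m K M : ℕ} (hk : k ≤ K) (hm : m ≤ M) (F : 𝓢(E, V)) :
    SchwartzMap.seminorm ℝ k m F ≤ schwartzSum K M F := by
  refine (single_le_sum (f := fun m => SchwartzMap.seminorm ℝ k m F)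
    (fun _ _ => apply_nonneg _ _) (mem_range.2 (Nat.lt_succ_of_le hm))).trans ?_
  exact single_le_sum (f := fun k => ∑ m ∈ range (M + 1), SchwartzMap.seminorm ℝ k m F)
    (fun _ _ => sum_nonneg fun _ _ => apply_nonneg _ _) (mem_range.2 (Nat.lt_succ_of_le hk))

lemma seminorm_fderivCLM_le (k m : ℕ) (F : 𝓢(E, V)) :
    SchwartzMap.seminorm ℝ k m (SchwartzMap.fderivCLM ℝ E V F) ≤
      SchwartzMap.seminorm ℝ k (m + 1) F := by
  refine SchwartzMap.seminorm_le_bound ℝ k m _ (apply_nonneg _ _) fun x => ?_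
  have h : (SchwartzMap.fderivCLM ℝ E V F : E → E →L[ℝ] V) = fderiv ℝ F := by
    ext1 y; exact SchwartzMap.fderivCLM_apply ℝ F y
  rw [h, norm_iteratedFDeriv_fderiv]
  exact SchwartzMap.le_seminorm ℝ k (m + 1) F x

lemma schwartzSum_fderivCLM_le (K M : ℕ) (F : 𝓢(E, V)) :
    schwartzSum K M (SchwartzMap.fderivCLM ℝ E V F) ≤ schwartzSum K (M + 1) F := by
  unfold schwartzSum
  refine sum_le_sum fun k _ => ?_
  rw [sum_range_succ' _ (M + 1)]
  refine (sum_le_sum fun m _ => seminorm_fderivCLM_le k m F).trans ?_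
  exact le_add_of_nonneg_right (apply_nonneg _ _)

lemma pow_mul_norm_smul_le (F : 𝓢(E, V)) (j : ℕ) {l : ℝ} (hl : 0 < l) {ξ : E} (hξ : l ≤ ‖ξ‖)
    (s : ℝ) :
    |s| ^ j * ‖F (s • ξ)‖ ≤ ((l ^ j)⁻¹ * SchwartzMap.seminorm ℝ j 0 F +
      (l ^ (j + 2))⁻¹ * SchwartzMap.seminorm ℝ (j + 2) 0 F) * (1 + s ^ 2)⁻¹ := by
  have key (i : ℕ) : |s| ^ i * ‖F (s • ξ)‖ ≤ (l ^ i)⁻¹ * SchwartzMap.seminorm ℝ i 0 F := by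
    have h := SchwartzMap.norm_pow_mul_le_seminorm ℝ F i (s • ξ)
    rw [le_inv_mul_iff₀ (by positivity)]
    refine le_trans ?_ h
    rw [norm_smul, mul_pow, Real.norm_eq_abs, ← mul_assoc, mul_comm (l ^ i)]
    gcongr
  rw [← div_eq_mul_inv, le_div_iff₀ (by positivity)]
  have h1 := key j
  have h2 := key (j + 2)
  have h3 : |s| ^ (j + 2) = |s| ^ j * s ^ 2 := by rw [pow_add, sq_abs]
  rw [h3] at h2
  nlinarith

end SchwartzSum

variable {V : Type} [NormedAddCommGroup V] [NormedSpace ℂ V]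

/-- `∫ s ^ j e^{2πisp} F(sξ) ds` as a function of `(p, ξ)`. -/
def radialWave (j : ℕ) (F : E → V) (q : ℝ × E) : V :=
  ∫ s : ℝ, ((s : ℂ) ^ j * waveKernel s q.1) • F (s • q.2)

lemma norm_radialWave_integrand (j : ℕ) (F : E → V) (q : ℝ × E) (s : ℝ) :
    ‖((s : ℂ) ^ j * waveKernel s q.1) • F (s • q.2)‖ = |s| ^ j * ‖F (s • q.2)‖ := by
  rw [norm_smul, norm_mul, norm_waveKernel, mul_one, norm_pow, Complex.norm_real,
    Real.norm_eq_abs]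

lemma continuous_radialWave_integrand (j : ℕ) (F : 𝓢(E, V)) (q : ℝ × E) :
    Continuous fun s : ℝ => ((s : ℂ) ^ j * waveKernel s q.1) • F (s • q.2) := by
  have h1 : Continuous fun s : ℝ => waveKernel s q.1 :=
    continuous_waveKernel.comp (by fun_prop : Continuous fun s : ℝ => (s, q.1))
  have h2 : Continuous fun s : ℝ => F (s • q.2) := F.continuous.comp (by fun_prop)
  fun_prop

lemma integrable_radialWave (j : ℕ) (F : 𝓢(E, V)) {q : ℝ × E} (hq : q.2 ≠ 0) :
    Integrable fun s : ℝ => ((s : ℂ) ^ j * waveKernel s q.1) • F (s • q.2) := by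
  refine Integrable.mono' (integrable_inv_one_add_sq.const_mul
    ((‖q.2‖ ^ j)⁻¹ * SchwartzMap.seminorm ℝ j 0 F +
      (‖q.2‖ ^ (j + 2))⁻¹ * SchwartzMap.seminorm ℝ (j + 2) 0 F))
    (continuous_radialWave_integrand j F q).aestronglyMeasurable (ae_of_all _ fun s => ?_)
  rw [norm_radialWave_integrand]
  exact pow_mul_norm_smul_le F j (norm_pos_iff.2 hq) le_rfl s

lemma norm_radialWave_le (j : ℕ) (F : 𝓢(E, V)) (p : ℝ) {ω : E} (hω : ‖ω‖ = 1) :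
    ‖radialWave j F (p, ω)‖ ≤ 2 * π * schwartzSum (j + 2) 0 F := by
  have h0 : ∀ s : ℝ, ‖((s : ℂ) ^ j * waveKernel s p) • F (s • ω)‖ ≤
      (2 * schwartzSum (j + 2) 0 F) * (1 + s ^ 2)⁻¹ := fun s => by
    rw [norm_radialWave_integrand j F (p, ω) s]
    refine (pow_mul_norm_smul_le F j one_pos hω.ge s).trans ?_
    have h1 := seminorm_le_schwartzSum (show j ≤ j + 2 by omega) le_rfl (m := 0) F
    have h2 := seminorm_le_schwartzSum (show j + 2 ≤ j + 2 by omega) le_rfl (m := 0) F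
    gcongr
    simp only [one_pow, inv_one, one_mul]
    linarith
  refine (norm_integral_le_of_norm_le (integrable_inv_one_add_sq.const_mul _)
    (ae_of_all _ h0)).trans_eq ?_
  rw [integral_const_mul, integral_univ_inv_one_add_sq]
  ring

/-- The bounded linear map recombining the two pieces of the derivative of `radialWave`. -/
def waveFst : V →L[ℝ] (ℝ × E →L[ℝ] V) :=
  (2 * π * I : ℂ) • ContinuousLinearMap.smulRightL ℝ (ℝ × E) V (ContinuousLinearMap.fst ℝ ℝ E)

/-- Precomposition with the second projection. -/
def waveSnd : (E →L[ℝ] V) →L[ℝ] (ℝ × E →L[ℝ] V) :=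
  (ContinuousLinearMap.compL ℝ (ℝ × E) E V).flip (ContinuousLinearMap.snd ℝ ℝ E)

lemma hasFDerivAt_radialWave_integrand (j : ℕ) (F : 𝓢(E, V)) (q : ℝ × E) (s : ℝ) :
    HasFDerivAt (fun q : ℝ × E => ((s : ℂ) ^ j * waveKernel s q.1) • F (s • q.2))
      (waveFst (((s : ℂ) ^ (j + 1) * waveKernel s q.1) • F (s • q.2)) +
       waveSnd (((s : ℂ) ^ (j + 1) * waveKernel s q.1) •
        SchwartzMap.fderivCLM ℝ E V F (s • q.2))) q := by
  have h1 : HasFDerivAt (fun q : ℝ × E => (s : ℂ) ^ j * waveKernel s q.1)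
      ((ContinuousLinearMap.fst ℝ ℝ E).smulRight
        ((s : ℂ) ^ j * (2 * π * I * s * waveKernel s q.1))) q := by
    have h := (hasDerivAt_waveKernel_left q.1 s).const_mul ((s : ℂ) ^ j)
    have h' := h.hasFDerivAt.comp q (hasFDerivAt_fst (𝕜 := ℝ) (E := ℝ) (F := E) (p := q))
    simp only [Function.comp_def, waveKernel_comm _ s] at h'
    refine h'.congr_fderiv ?_
    ext v <;> simp
  have h2 : HasFDerivAt (fun q : ℝ × E => F (s • q.2))
      ((fderiv ℝ F (s • q.2)).comp (s • ContinuousLinearMap.snd ℝ ℝ E)) q :=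
    (F.differentiableAt (x := s • q.2)).hasFDerivAt.comp q
      ((hasFDerivAt_snd (𝕜 := ℝ) (E := ℝ) (F := E) (p := q)).const_smul s)
  refine (h1.smul h2).congr_fderiv ?_
  ext v
  · simp [waveFst, waveSnd, smul_smul]
    congr 1; ring
  · simp [waveFst, waveSnd, pow_succ]
    rw [← Complex.coe_smul, smul_smul]
    congr 1; ring

variable [CompleteSpace V]

lemma hasFDerivAt_radialWave (j : ℕ) (F : 𝓢(E, V)) {q : ℝ × E} (hq : q.2 ≠ 0) :
    HasFDerivAt (radialWave j F) (waveFst (radialWave (j + 1) F q) +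
      waveSnd (radialWave (j + 1) (SchwartzMap.fderivCLM ℝ E V F) q)) q := by
  have hq' : 0 < ‖q.2‖ := norm_pos_iff.2 hq
  set l := ‖q.2‖ / 2 with hl
  have hl0 : 0 < l := by positivity
  have hs : {x : ℝ × E | l < ‖x.2‖} ∈ 𝓝 q :=
    (isOpen_lt continuous_const (by fun_prop)).mem_nhds (by simp [hl, hq])
  have i1 := integrable_radialWave (j + 1) F hq
  have i2 := integrable_radialWave (j + 1) (SchwartzMap.fderivCLM ℝ E V F) hq
  have j1 := (waveFst (E := E) (V := V)).integrable_comp i1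
  have j2 := (waveSnd (E := E) (V := V)).integrable_comp i2
  set A := ‖waveFst (E := E) (V := V)‖
  set B := ‖waveSnd (E := E) (V := V)‖
  have key := hasFDerivAt_integral_of_dominated_of_fderiv_le (𝕜 := ℝ) (μ := volume)
    (F := fun (q : ℝ × E) (s : ℝ) => ((s : ℂ) ^ j * waveKernel s q.1) • F (s • q.2))
    (F' := fun q s => (waveFst (((s : ℂ) ^ (j + 1) * waveKernel s q.1) • F (s • q.2)) +
       waveSnd (((s : ℂ) ^ (j + 1) * waveKernel s q.1) •
        SchwartzMap.fderivCLM ℝ E V F (s • q.2)))) (x₀ := q)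
    (bound := fun s => (A * ((l ^ (j + 1))⁻¹ * SchwartzMap.seminorm ℝ (j + 1) 0 F +
      (l ^ (j + 1 + 2))⁻¹ * SchwartzMap.seminorm ℝ (j + 1 + 2) 0 F) +
      B * ((l ^ (j + 1))⁻¹ * SchwartzMap.seminorm ℝ (j + 1) 0 (SchwartzMap.fderivCLM ℝ E V F) +
      (l ^ (j + 1 + 2))⁻¹ * SchwartzMap.seminorm ℝ (j + 1 + 2) 0 (SchwartzMap.fderivCLM ℝ E V F)))
        * (1 + s ^ 2)⁻¹) hs
    (Filter.Eventually.of_forall fun x => (continuous_radialWave_integrand j F x).aestronglyMeasurable)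
    (integrable_radialWave j F hq) (j1.add j2).aestronglyMeasurable ?_
    (integrable_inv_one_add_sq.const_mul _)
    (ae_of_all _ fun s x _ => hasFDerivAt_radialWave_integrand j F x s)
  · refine key.congr_fderiv ?_
    rw [integral_add j1 j2, ContinuousLinearMap.integral_comp_comm _ i1,
      ContinuousLinearMap.integral_comp_comm _ i2]
    rfl
  · refine ae_of_all _ fun s x (hx : l < ‖x.2‖) => ?_
    refine (norm_add_le _ _).trans ?_
    rw [add_mul]
    refine add_le_add ?_ ?_
    · refine (ContinuousLinearMap.le_opNorm _ _).trans ?_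
      rw [norm_radialWave_integrand (j + 1) F x s, mul_assoc]
      exact mul_le_mul_of_nonneg_left (pow_mul_norm_smul_le F (j + 1) hl0 hx.le s) (norm_nonneg _)
    · refine (ContinuousLinearMap.le_opNorm _ _).trans ?_
      rw [norm_radialWave_integrand (j + 1) (SchwartzMap.fderivCLM ℝ E V F) x s, mul_assoc]
      exact mul_le_mul_of_nonneg_left (pow_mul_norm_smul_le _ (j + 1) hl0 hx.le s) (norm_nonneg _)

lemma contDiffOn_radialWave_nat (m : ℕ) : ∀ (V : Type) [NormedAddCommGroup V] [NormedSpace ℂ V]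
    [CompleteSpace V] (j : ℕ) (F : 𝓢(E, V)), ContDiffOn ℝ m (radialWave j F) (punctured E) := by
  induction m with
  | zero =>
    intro V _ _ _ j F
    refine contDiffOn_zero.2 fun q hq => ?_
    exact (hasFDerivAt_radialWave j F (mem_punctured.1 hq)).continuousAt.continuousWithinAt
  | succ m ih =>
    intro V _ _ _ j F
    push_cast
    rw [contDiffOn_succ_iff_fderiv_of_isOpen isOpen_punctured]
    refine ⟨fun q hq => (hasFDerivAt_radialWave j F
      (mem_punctured.1 hq)).differentiableAt.differentiableWithinAt, by simp, ?_⟩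
    refine ContDiffOn.congr ?_ fun q hq => (hasFDerivAt_radialWave j F (mem_punctured.1 hq)).fderiv
    exact ((waveFst (E := E) (V := V)).contDiff.comp_contDiffOn (ih V (j + 1) F)).add
      ((waveSnd (E := E) (V := V)).contDiff.comp_contDiffOn (ih _ (j + 1) _))

lemma contDiffOn_radialWave (j : ℕ) (F : 𝓢(E, V)) :
    ContDiffOn ℝ (⊤ : ℕ∞) (radialWave j F) (punctured E) :=
  contDiffOn_infty.2 fun m => contDiffOn_radialWave_nat m V j F

lemma radialWave_by_parts (j : ℕ) (F : 𝓢(E, V)) {q : ℝ × E} (hq : q.2 ≠ 0) :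
    (2 * π * I * q.1 : ℂ) • radialWave j F q =
      -((j : ℂ) • radialWave (j - 1) F q + radialWave j (SchwartzMap.fderivCLM ℝ E V F) q q.2) := by
  have i1 := (integrable_radialWave j F hq).smul (2 * π * I * q.1 : ℂ)
  have i2 := (integrable_radialWave (j - 1) F hq).smul (j : ℂ)
  have i3 := integrable_radialWave j (SchwartzMap.fderivCLM ℝ E V F) hq
  have i4 := (ContinuousLinearMap.apply ℝ V q.2).integrable_comp i3
  have hd (s : ℝ) : HasDerivAt (fun s : ℝ => ((s : ℂ) ^ j * waveKernel s q.1) • F (s • q.2))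
      ((2 * π * I * q.1 : ℂ) • (((s : ℂ) ^ j * waveKernel s q.1) • F (s • q.2)) +
       ((j : ℂ) • (((s : ℂ) ^ (j - 1) * waveKernel s q.1) • F (s • q.2)) +
        ContinuousLinearMap.apply ℝ V q.2 (((s : ℂ) ^ j * waveKernel s q.1) •
          SchwartzMap.fderivCLM ℝ E V F (s • q.2)))) s := by
    have h1 : HasDerivAt (fun s : ℝ => (s : ℂ) ^ j) (j * (s : ℂ) ^ (j - 1)) s := by
      simpa using (hasDerivAt_pow j (s : ℂ)).comp_ofReal
    have h2 : HasDerivAt (fun s : ℝ => F (s • q.2)) (fderiv ℝ F (s • q.2) q.2) s := by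
      have := (F.differentiableAt (x := s • q.2)).hasFDerivAt.comp_hasDerivAt s
        ((hasDerivAt_id s).smul_const q.2)
      simpa [Function.comp_def] using this
    refine ((h1.mul (hasDerivAt_waveKernel_left s q.1)).smul h2).congr_deriv ?_
    simp only [ContinuousLinearMap.apply_apply, FunLike.coe_smul, Pi.smul_apply, Pi.mul_apply,
      SchwartzMap.fderivCLM_apply]
    module
  have h := integral_eq_zero_of_hasDerivAt_of_integrable hd (i1.add (i2.add i4))
    (integrable_radialWave j F hq)
  have e1 : ∫ s : ℝ, (2 * π * I * q.1 : ℂ) • (((s : ℂ) ^ j * waveKernel s q.1) • F (s • q.2)) =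
    (2 * π * I * q.1 : ℂ) • radialWave j F q := integral_smul _ _
  have e2 : ∫ s : ℝ, (j : ℂ) • (((s : ℂ) ^ (j - 1) * waveKernel s q.1) • F (s • q.2)) =
    (j : ℂ) • radialWave (j - 1) F q := integral_smul _ _
  have e3 : ∫ s : ℝ, ContinuousLinearMap.apply ℝ V q.2 (((s : ℂ) ^ j * waveKernel s q.1) •
      SchwartzMap.fderivCLM ℝ E V F (s • q.2)) =
      radialWave j (SchwartzMap.fderivCLM ℝ E V F) q q.2 :=
    ContinuousLinearMap.integral_comp_comm _ i3
  rw [integral_add (by exact i1) (by exact i2.add i4), integral_add (by exact i2) i4, e1, e2, e3] at h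
  exact eq_neg_of_add_eq_zero_left h

lemma exists_pow_mul_norm_radialWave_le (k : ℕ) : ∀ j : ℕ, ∃ C : ℝ, 0 ≤ C ∧ ∃ K M : ℕ,
    ∀ (V : Type) [NormedAddCommGroup V] [NormedSpace ℂ V] [CompleteSpace V] (F : 𝓢(E, V))
      (p : ℝ) (ω : E), ‖ω‖ = 1 → |p| ^ k * ‖radialWave j F (p, ω)‖ ≤ C * schwartzSum K M F := by
  induction k with
  | zero =>
    refine fun j => ⟨2 * π, by positivity, j + 2, 0, fun V _ _ _ F p ω hω => ?_⟩
    simpa using norm_radialWave_le j F p hω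
  | succ k ih =>
    intro j
    obtain ⟨C₁, hC₁, K₁, M₁, h₁⟩ := ih (j - 1)
    obtain ⟨C₂, hC₂, K₂, M₂, h₂⟩ := ih j
    refine ⟨j * C₁ + C₂, by positivity, max K₁ K₂, max M₁ (M₂ + 1), fun V _ _ _ F p ω hω => ?_⟩
    have hω0 : (p, ω).2 ≠ 0 := mem_punctured.1 (mem_punctured_of_norm_eq_one hω)
    have hp : |p| * ‖radialWave j F (p, ω)‖ ≤ j * ‖radialWave (j - 1) F (p, ω)‖ +
        ‖radialWave j (SchwartzMap.fderivCLM ℝ E V F) (p, ω)‖ := by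
      have h := congrArg norm (radialWave_by_parts j F hω0)
      have hn : ‖(2 * π * I * p : ℂ)‖ = 2 * π * |p| := by
        simp [abs_of_pos Real.pi_pos]
      rw [norm_smul, norm_neg, hn] at h
      have h3 := norm_add_le ((j : ℂ) • radialWave (j - 1) F (p, ω))
        (radialWave j (SchwartzMap.fderivCLM ℝ E V F) (p, ω) ω)
      have h4 := (radialWave j (SchwartzMap.fderivCLM ℝ E V F) (p, ω)).le_opNorm ω
      rw [hω, mul_one] at h4
      rw [norm_smul, Complex.norm_natCast] at h3
      have h5 : 1 * (|p| * ‖radialWave j F (p, ω)‖) ≤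
          2 * π * (|p| * ‖radialWave j F (p, ω)‖) := by
        gcongr
        linarith [Real.pi_gt_three]
      linarith
    have a₁ := h₁ V F p ω hω
    have a₂ := h₂ _ (SchwartzMap.fderivCLM ℝ E V F) p ω hω
    have b₁ := schwartzSum_mono (le_max_left K₁ K₂) (le_max_left M₁ (M₂ + 1)) F
    have b₂ := (schwartzSum_fderivCLM_le K₂ M₂ F).trans
      (schwartzSum_mono (le_max_right K₁ K₂) (le_max_right M₁ (M₂ + 1)) F)
    calc |p| ^ (k + 1) * ‖radialWave j F (p, ω)‖ = |p| ^ k * (|p| * ‖radialWave j F (p, ω)‖) := by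
          ring
      _ ≤ |p| ^ k * (j * ‖radialWave (j - 1) F (p, ω)‖ +
        ‖radialWave j (SchwartzMap.fderivCLM ℝ E V F) (p, ω)‖) := by gcongr
      _ = j * (|p| ^ k * ‖radialWave (j - 1) F (p, ω)‖) +
        |p| ^ k * ‖radialWave j (SchwartzMap.fderivCLM ℝ E V F) (p, ω)‖ := by ring
      _ ≤ j * (C₁ * schwartzSum K₁ M₁ F) +
        C₂ * schwartzSum K₂ M₂ (SchwartzMap.fderivCLM ℝ E V F) := by gcongr
      _ ≤ j * (C₁ * schwartzSum (max K₁ K₂) (max M₁ (M₂ + 1)) F) +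
        C₂ * schwartzSum (max K₁ K₂) (max M₁ (M₂ + 1)) F := by gcongr
      _ = _ := by ring

lemma exists_pow_mul_norm_iteratedFDeriv_radialWave_le (k m : ℕ) :
    ∀ j : ℕ, ∃ C : ℝ, 0 ≤ C ∧ ∃ K M : ℕ,
    ∀ (V : Type) [NormedAddCommGroup V] [NormedSpace ℂ V] [CompleteSpace V] (F : 𝓢(E, V))
      (p : ℝ) (ω : E), ‖ω‖ = 1 →
        |p| ^ k * ‖iteratedFDeriv ℝ m (radialWave j F) (p, ω)‖ ≤ C * schwartzSum K M F := by
  induction m with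
  | zero =>
    intro j
    obtain ⟨C, hC, K, M, h⟩ := exists_pow_mul_norm_radialWave_le (E := E) k j
    refine ⟨C, hC, K, M, fun V _ _ _ F p ω hω => ?_⟩
    simpa using h V F p ω hω
  | succ m ih =>
    intro j
    obtain ⟨C, hC, K, M, h⟩ := ih (j + 1)
    refine ⟨2 * π * C + C, by positivity, K, M + 1, fun V _ _ _ F p ω hω => ?_⟩
    have hU := mem_punctured_of_norm_eq_one (p := p) hω
    have c1 := (contDiffOn_radialWave (j + 1) F).contDiffAt (isOpen_punctured.mem_nhds hU)
    have c2 := (contDiffOn_radialWave (j + 1) (SchwartzMap.fderivCLM ℝ E V F)).contDiffAt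
      (isOpen_punctured.mem_nhds hU)
    have hm : (m : WithTop ℕ∞) ≤ (⊤ : ℕ∞) := by exact_mod_cast le_top
    have d1 := (waveFst (E := E) (V := V)).norm_iteratedFDeriv_comp_left c1 hm
    have d2 := (waveSnd (E := E) (V := V)).norm_iteratedFDeriv_comp_left c2 hm
    have n1 : ‖waveFst (E := E) (V := V)‖ ≤ 2 * π := by
      refine ContinuousLinearMap.opNorm_le_bound _ (by positivity) fun v => ?_
      have h1 : ‖(ContinuousLinearMap.fst ℝ ℝ E).smulRight v‖ ≤ ‖v‖ := by
        rw [ContinuousLinearMap.norm_smulRight_apply]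
        exact mul_le_of_le_one_left (norm_nonneg _) (ContinuousLinearMap.norm_fst_le ..)
      have h2 : waveFst (E := E) v = (2 * π * I : ℂ) • (ContinuousLinearMap.fst ℝ ℝ E).smulRight v :=
        rfl
      rw [h2, norm_smul]
      have hn : ‖(2 * π * I : ℂ)‖ = 2 * π := by simp [abs_of_pos Real.pi_pos]
      rw [hn]
      gcongr
    have n2 : ‖waveSnd (E := E) (V := V)‖ ≤ 1 := by
      refine ContinuousLinearMap.opNorm_le_bound _ zero_le_one fun v => ?_
      rw [one_mul]
      refine (ContinuousLinearMap.opNorm_comp_le v _).trans ?_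
      exact mul_le_of_le_one_right (norm_nonneg _) (ContinuousLinearMap.norm_snd_le ..)
    have e : fderiv ℝ (radialWave j F) =ᶠ[𝓝 (p, ω)] (waveFst ∘ radialWave (j + 1) F) +
        (waveSnd ∘ radialWave (j + 1) (SchwartzMap.fderivCLM ℝ E V F)) :=
      Filter.eventually_of_mem (isOpen_punctured.mem_nhds hU) fun q hq =>
        (hasFDerivAt_radialWave j F (mem_punctured.1 hq)).fderiv
    have a₁ := h V F p ω hω
    have a₂ := h _ (SchwartzMap.fderivCLM ℝ E V F) p ω hω
    have b₁ := schwartzSum_mono (le_refl K) (Nat.le_succ M) F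
    have b₂ := schwartzSum_fderivCLM_le K M F
    rw [← norm_iteratedFDeriv_fderiv, (e.iteratedFDeriv ℝ m).eq_of_nhds,
      iteratedFDeriv_add_apply ((c1.continuousLinearMap_comp waveFst).of_le hm)
        ((c2.continuousLinearMap_comp waveSnd).of_le hm)]
    calc _ ≤ |p| ^ k * (2 * π * ‖iteratedFDeriv ℝ m (radialWave (j + 1) F) (p, ω)‖ +
          1 * ‖iteratedFDeriv ℝ m
            (radialWave (j + 1) (SchwartzMap.fderivCLM ℝ E V F)) (p, ω)‖) := by
          gcongr
          refine (norm_add_le _ _).trans (add_le_add (d1.trans ?_) (d2.trans ?_)) <;> gcongr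
      _ = 2 * π * (|p| ^ k * ‖iteratedFDeriv ℝ m (radialWave (j + 1) F) (p, ω)‖) +
          |p| ^ k * ‖iteratedFDeriv ℝ m
            (radialWave (j + 1) (SchwartzMap.fderivCLM ℝ E V F)) (p, ω)‖ := by ring
      _ ≤ 2 * π * (C * schwartzSum K M F) + C * schwartzSum K M (SchwartzMap.fderivCLM ℝ E V F) := by
          gcongr
      _ ≤ 2 * π * (C * schwartzSum K (M + 1) F) + C * schwartzSum K (M + 1) F := by gcongr
      _ = _ := by ring

end Forward

section Twist

variable {E : Type} [NormedAddCommGroup E]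

lemma mapsTo_twistMap (u : E → ℝ) :
    Set.MapsTo (fun q : ℝ × E => (q.1 * u q.2, q.2)) (punctured E) (punctured E) :=
  fun _ hq => mem_punctured.2 (mem_punctured.1 hq)

variable [NormedSpace ℝ E]

/-- The function `(p, ξ) ↦ u(ξ) Φ(p u(ξ), ξ)`. -/
def twist {V : Type} [NormedAddCommGroup V] [NormedSpace ℝ V] (u : E → ℝ) (Φ : ℝ × E → V)
    (q : ℝ × E) : V := u q.2 • Φ (q.1 * u q.2, q.2)

variable {V : Type} [NormedAddCommGroup V] [NormedSpace ℝ V]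

lemma natCast_le_infty (m : ℕ) : (m : WithTop ℕ∞) ≤ (⊤ : ℕ∞) := by exact_mod_cast le_top

lemma contDiffOn_snd_punctured {u : E → ℝ} (hu : ContDiffOn ℝ (⊤ : ℕ∞) u {x | x ≠ 0}) :
    ContDiffOn ℝ (⊤ : ℕ∞) (fun q : ℝ × E => u q.2) (punctured E) :=
  hu.comp contDiff_snd.contDiffOn fun _ hq => mem_punctured.1 hq

lemma contDiffOn_twistMap {u : E → ℝ} (hu : ContDiffOn ℝ (⊤ : ℕ∞) u {x | x ≠ 0}) :
    ContDiffOn ℝ (⊤ : ℕ∞) (fun q : ℝ × E => (q.1 * u q.2, q.2)) (punctured E) :=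
  (contDiff_fst.contDiffOn.mul (contDiffOn_snd_punctured hu)).prodMk contDiff_snd.contDiffOn

lemma contDiffOn_twist {u : E → ℝ} (hu : ContDiffOn ℝ (⊤ : ℕ∞) u {x | x ≠ 0}) {Φ : ℝ × E → V}
    (hΦ : ContDiffOn ℝ (⊤ : ℕ∞) Φ (punctured E)) :
    ContDiffOn ℝ (⊤ : ℕ∞) (twist u Φ) (punctured E) :=
  (contDiffOn_snd_punctured hu).smul (hΦ.comp (contDiffOn_twistMap hu) (mapsTo_twistMap u))

lemma exists_norm_iteratedFDeriv_le_sphere [FiniteDimensional ℝ E] {W : ℝ × E → V}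
    (hW : ContDiffOn ℝ (⊤ : ℕ∞) W (punctured E)) (m : ℕ) :
    ∃ A : ℝ, 1 ≤ A ∧ ∀ i ≤ m, ∀ ω : E, ‖ω‖ = 1 → ‖iteratedFDeriv ℝ i W (0, ω)‖ ≤ A := by
  have key (i : ℕ) : ∃ A : ℝ, ∀ ω : E, ‖ω‖ = 1 → ‖iteratedFDeriv ℝ i W (0, ω)‖ ≤ A := by
    have hc : ContinuousOn (iteratedFDeriv ℝ i W) (punctured E) :=
      ContinuousOn.continuousOn_iteratedFDeriv hW isOpen_punctured (natCast_le_infty i)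
    have hc' : ContinuousOn (fun ω : E => iteratedFDeriv ℝ i W (0, ω)) (Metric.sphere 0 1) :=
      hc.comp (by fun_prop) fun ω hω => mem_punctured_of_norm_eq_one (by simpa using hω)
    obtain ⟨A, hA⟩ := (isCompact_sphere (0 : E) 1).exists_bound_of_continuousOn hc'
    exact ⟨A, fun ω hω => hA ω (by simpa using hω)⟩
  choose A hA using key
  refine ⟨1 + ∑ i ∈ range (m + 1), |A i|, ?_, fun i hi ω hω => ?_⟩
  · exact le_add_of_nonneg_right (sum_nonneg fun _ _ => abs_nonneg _)
  · refine (hA i ω hω).trans ((le_abs_self _).trans ?_)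
    refine (single_le_sum (f := fun i => |A i|) (fun _ _ => abs_nonneg _)
      (mem_range.2 (Nat.lt_succ_of_le hi))).trans ?_
    linarith

lemma iteratedFDeriv_eq_of_translate {W W₁ : ℝ × E → V} {p : ℝ}
    (h : ∀ q, W (q + (p, 0)) = W₁ q) (i : ℕ) (ξ : E) :
    iteratedFDeriv ℝ i W (p, ξ) = iteratedFDeriv ℝ i W₁ (0, ξ) := by
  have := iteratedFDeriv_comp_add_right (𝕜 := ℝ) (f := W) i (p, 0) (0, ξ)
  rw [show ((0 : ℝ), ξ) + (p, 0) = (p, ξ) by simp] at this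
  rw [← this]
  congr 1
  exact funext h

lemma exists_norm_iteratedFDeriv_twistMap_le [FiniteDimensional ℝ E] {u : E → ℝ}
    (hu : ContDiffOn ℝ (⊤ : ℕ∞) u {x | x ≠ 0}) (m : ℕ) :
    ∃ A : ℝ, 1 ≤ A ∧ ∀ i ≤ m, ∀ (p : ℝ) (ω : E), ‖ω‖ = 1 →
      ‖iteratedFDeriv ℝ i (fun q : ℝ × E => (q.1 * u q.2, q.2)) (p, ω)‖ ≤ A * (1 + |p|) := by
  obtain ⟨A, hA1, hA⟩ := exists_norm_iteratedFDeriv_le_sphere (contDiffOn_twistMap hu) m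
  have hH : ContDiffOn ℝ (⊤ : ℕ∞) (fun q : ℝ × E => (u q.2, (0 : E))) (punctured E) :=
    (contDiffOn_snd_punctured hu).prodMk contDiffOn_const
  obtain ⟨B, hB1, hB⟩ := exists_norm_iteratedFDeriv_le_sphere hH m
  refine ⟨A + B, by linarith, fun i hi p ω hω => ?_⟩
  have hU := isOpen_punctured.mem_nhds (mem_punctured_of_norm_eq_one (p := 0) hω)
  have hm := natCast_le_infty i
  have c1 : ContDiffAt ℝ i (fun q : ℝ × E => (q.1 * u q.2, q.2)) (0, ω) :=
    ((contDiffOn_twistMap hu).contDiffAt hU).of_le hm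
  have c2 : ContDiffAt ℝ i (fun q : ℝ × E => (u q.2, (0 : E))) (0, ω) :=
    (hH.contDiffAt hU).of_le hm
  rw [iteratedFDeriv_eq_of_translate (W₁ := (fun q : ℝ × E => (q.1 * u q.2, q.2)) +
      p • (fun q : ℝ × E => (u q.2, (0 : E)))) (fun q => by simp; ring),
    iteratedFDeriv_add_apply c1 (show ContDiffAt ℝ i (p • _) _ from c2.const_smul p),
    iteratedFDeriv_const_smul_apply c2]
  refine (norm_add_le _ _).trans ?_
  rw [norm_smul, Real.norm_eq_abs]
  have h1 := hA i hi ω hω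
  have h2 := mul_le_mul_of_nonneg_left (hB i hi ω hω) (abs_nonneg p)
  nlinarith [abs_nonneg p]

lemma exists_norm_iteratedFDeriv_twist_le [FiniteDimensional ℝ E] {u : E → ℝ}
    (hu : ContDiffOn ℝ (⊤ : ℕ∞) u {x | x ≠ 0}) (hu1 : ∀ ω : E, ‖ω‖ = 1 → u ω = 1) (m : ℕ) :
    ∃ C : ℝ, 0 ≤ C ∧ ∀ (V : Type) [NormedAddCommGroup V] [NormedSpace ℝ V] (Φ : ℝ × E → V),
      ContDiffOn ℝ (⊤ : ℕ∞) Φ (punctured E) → ∀ (p : ℝ) (ω : E), ‖ω‖ = 1 →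
      ‖iteratedFDeriv ℝ m (twist u Φ) (p, ω)‖ ≤ C * (1 + |p|) ^ m *
        ∑ j ∈ range (m + 1), ‖iteratedFDeriv ℝ j Φ (p, ω)‖ := by
  obtain ⟨A, hA1, hA⟩ := exists_norm_iteratedFDeriv_twistMap_le hu m
  obtain ⟨B, hB1, hB⟩ := exists_norm_iteratedFDeriv_le_sphere (contDiffOn_snd_punctured hu) m
  refine ⟨∑ i ∈ range (m + 1), (m.choose i : ℝ) * B * ((m - i).factorial * A ^ (m - i)),
    by positivity, fun V _ _ Φ hΦ p ω hω => ?_⟩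
  have hU := mem_punctured_of_norm_eq_one (p := p) hω
  have ho := isOpen_punctured (E := E)
  set S := ∑ j ∈ range (m + 1), ‖iteratedFDeriv ℝ j Φ (p, ω)‖ with hS
  have hS0 : 0 ≤ S := sum_nonneg fun _ _ => norm_nonneg _
  have hG : (((p, ω) : ℝ × E).1 * u ((p, ω) : ℝ × E).2, ((p, ω) : ℝ × E).2) = (p, ω) := by
    simp [hu1 ω hω]
  have hp : 1 ≤ 1 + |p| := by linarith [abs_nonneg p]
  have hD : 1 ≤ A * (1 + |p|) := one_le_mul_of_one_le_of_one_le hA1 hp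
  have comp (k : ℕ) (hk : k ≤ m) :
      ‖iteratedFDerivWithin ℝ k (Φ ∘ fun q : ℝ × E => (q.1 * u q.2, q.2)) (punctured E) (p, ω)‖ ≤
        k.factorial * S * (A * (1 + |p|)) ^ k := by
    refine norm_iteratedFDerivWithin_comp_le hΦ (contDiffOn_twistMap hu) (natCast_le_infty k)
      ho.uniqueDiffOn ho.uniqueDiffOn (mapsTo_twistMap u) hU (fun i hi => ?_) fun i hi1 hi => ?_
    · rw [hG, iteratedFDerivWithin_of_isOpen i ho hU]
      exact single_le_sum (f := fun j => ‖iteratedFDeriv ℝ j Φ (p, ω)‖) (fun _ _ => norm_nonneg _)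
        (mem_range.2 (by omega))
    · rw [iteratedFDerivWithin_of_isOpen i ho hU]
      exact (hA i (hi.trans hk) p ω hω).trans (le_self_pow₀ hD (by omega))
  rw [← iteratedFDerivWithin_of_isOpen m ho hU]
  refine (norm_iteratedFDerivWithin_smul_le (contDiffOn_snd_punctured hu)
    (hΦ.comp (contDiffOn_twistMap hu) (mapsTo_twistMap u)) ho.uniqueDiffOn hU
    (natCast_le_infty m)).trans ?_
  rw [sum_mul, sum_mul]
  refine sum_le_sum fun i hi => ?_
  have hi : i ≤ m := Nat.lt_succ_iff.1 (mem_range.1 hi)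
  have h1 : ‖iteratedFDerivWithin ℝ i (fun q : ℝ × E => u q.2) (punctured E) (p, ω)‖ ≤ B := by
    rw [iteratedFDerivWithin_of_isOpen i ho hU,
      iteratedFDeriv_eq_of_translate (W₁ := fun q : ℝ × E => u q.2) (fun q => by simp)]
    exact hB i hi ω hω
  calc _ ≤ (m.choose i : ℝ) * B * ((m - i).factorial * S * (A * (1 + |p|)) ^ (m - i)) := by
        gcongr
        exact comp _ (Nat.sub_le _ _)
    _ = (m.choose i : ℝ) * B * ((m - i).factorial * A ^ (m - i)) * (1 + |p|) ^ (m - i) * S := by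
        rw [mul_pow]; ring
    _ ≤ _ := by
        gcongr
        exact Nat.sub_le _ _

end Twist

section Profile

variable {E : Type} [NormedAddCommGroup E] [NormedSpace ℝ E]

/-- Smooth functions on `ℝ × (E ∖ {0})`, homogeneous of degree `-a`, rapidly decreasing together
with all their derivatives in the first variable, uniformly over the unit sphere. -/
structure RadialClass {V : Type} [NormedAddCommGroup V] [NormedSpace ℝ V] (a : ℕ)
    (Φ : ℝ × E → V) : Prop where
  smooth : ContDiffOn ℝ (⊤ : ℕ∞) Φ (punctured E)
  homog : ∀ t : ℝ, 0 < t → ∀ q : ℝ × E, q.2 ≠ 0 → t ^ a • Φ (t • q) = Φ q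
  decay : ∀ k m : ℕ, ∃ C : ℝ, ∀ (r : ℝ) (ω : E), ‖ω‖ = 1 →
    (1 + r ^ 2) ^ k * ‖iteratedFDeriv ℝ m Φ (r, ω)‖ ≤ C

section Real

variable {V W : Type} [NormedAddCommGroup V] [NormedSpace ℝ V]
  [NormedAddCommGroup W] [NormedSpace ℝ W] {a : ℕ} {Φ : ℝ × E → V}

lemma RadialClass.contDiffAt (h : RadialClass a Φ) {q : ℝ × E} (hq : q.2 ≠ 0) :
    ContDiffAt ℝ (⊤ : ℕ∞) Φ q :=
  h.smooth.contDiffAt (isOpen_punctured.mem_nhds (mem_punctured.2 hq))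

lemma RadialClass.differentiableAt (h : RadialClass a Φ) {q : ℝ × E} (hq : q.2 ≠ 0) :
    DifferentiableAt ℝ Φ q :=
  (h.contDiffAt hq).differentiableAt (by simp)

lemma contDiffOn_fderiv_punctured (h : ContDiffOn ℝ (⊤ : ℕ∞) Φ (punctured E)) :
    ContDiffOn ℝ (⊤ : ℕ∞) (fderiv ℝ Φ) (punctured E) :=
  ((contDiffOn_infty_iff_fderiv_of_isOpen isOpen_punctured).1 h).2

lemma norm_iteratedFDeriv_clm_fderiv_le (h : ContDiffOn ℝ (⊤ : ℕ∞) Φ (punctured E))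
    {L : (ℝ × E →L[ℝ] V) →L[ℝ] W} (hL : ‖L‖ ≤ 1) (m : ℕ) {q : ℝ × E} (hq : q.2 ≠ 0) :
    ‖iteratedFDeriv ℝ m (fun q => L (fderiv ℝ Φ q)) q‖ ≤ ‖iteratedFDeriv ℝ (m + 1) Φ q‖ := by
  have h1 := (contDiffOn_fderiv_punctured h).contDiffAt
    (isOpen_punctured.mem_nhds (mem_punctured.2 hq))
  refine (L.norm_iteratedFDeriv_comp_left h1 (natCast_le_infty m)).trans ?_
  rw [norm_iteratedFDeriv_fderiv]
  exact mul_le_of_le_one_left (norm_nonneg _) hL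

lemma RadialClass.clm_fderiv (h : RadialClass a Φ) {L : (ℝ × E →L[ℝ] V) →L[ℝ] W}
    (hL : ‖L‖ ≤ 1) : RadialClass (a + 1) (fun q => L (fderiv ℝ Φ q)) where
  smooth := L.contDiff.comp_contDiffOn (contDiffOn_fderiv_punctured h.smooth)
  homog t ht q hq := by
    have hq' : (t • q).2 ≠ 0 := by simp [ht.ne', hq]
    have h1 : HasFDerivAt (fun q : ℝ × E => t ^ a • Φ (t • q))
        (t ^ a • (fderiv ℝ Φ (t • q)).comp (t • ContinuousLinearMap.id ℝ (ℝ × E))) q :=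
      ((h.differentiableAt hq').hasFDerivAt.comp q ((hasFDerivAt_id q).const_smul t)).const_smul _
    have h2 : HasFDerivAt Φ (t ^ a • (fderiv ℝ Φ (t • q)).comp
        (t • ContinuousLinearMap.id ℝ (ℝ × E))) q :=
      h1.congr_of_eventuallyEq <| Filter.eventually_of_mem
        (isOpen_punctured.mem_nhds (mem_punctured.2 hq)) fun x hx =>
          (h.homog t ht x (mem_punctured.1 hx)).symm
    rw [h2.fderiv, ← map_smul]
    congr 1
    ext v <;> simp [pow_succ, smul_smul]
  decay k m := by
    obtain ⟨C, hC⟩ := h.decay k (m + 1)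
    refine ⟨C, fun r ω hω => le_trans ?_ (hC r ω hω)⟩
    have := norm_iteratedFDeriv_clm_fderiv_le h.smooth hL m (q := (r, ω))
      (mem_punctured.1 (mem_punctured_of_norm_eq_one hω))
    gcongr

lemma RadialClass.norm_le (h : RadialClass a Φ) {k : ℕ} {B : ℝ}
    (hB : ∀ (r : ℝ) (ω : E), ‖ω‖ = 1 → (1 + r ^ 2) ^ k * ‖Φ (r, ω)‖ ≤ B) {ξ : E} (hξ : ξ ≠ 0)
    (r : ℝ) : ‖Φ (r, ξ)‖ ≤ (‖ξ‖ ^ a)⁻¹ * B * ((1 + (r / ‖ξ‖) ^ 2) ^ k)⁻¹ := by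
  have hl : 0 < ‖ξ‖ := norm_pos_iff.2 hξ
  have h1 := h.homog ‖ξ‖⁻¹ (by positivity) (r, ξ) hξ
  have h2 := hB (‖ξ‖⁻¹ * r) (‖ξ‖⁻¹ • ξ) (by simp [norm_smul, hl.ne'])
  have h3 : ((‖ξ‖⁻¹ * r, ‖ξ‖⁻¹ • ξ) : ℝ × E) = ‖ξ‖⁻¹ • (r, ξ) := rfl
  rw [h3, mul_comm, ← le_div_iff₀ (by positivity), div_eq_mul_inv] at h2
  rw [← h1, norm_smul, norm_pow, norm_inv, norm_norm, inv_pow, mul_assoc]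
  rw [div_eq_inv_mul]
  gcongr

/-- The derivative of `Φ(r, ξ)` in `ξ`. -/
def partialSnd (Φ : ℝ × E → V) (q : ℝ × E) : E →L[ℝ] V :=
  (ContinuousLinearMap.compL ℝ E (ℝ × E) V).flip (ContinuousLinearMap.inr ℝ ℝ E) (fderiv ℝ Φ q)

lemma norm_compL_inr_le :
    ‖(ContinuousLinearMap.compL ℝ E (ℝ × E) V).flip (ContinuousLinearMap.inr ℝ ℝ E)‖ ≤ 1 := by
  refine ContinuousLinearMap.opNorm_le_bound _ zero_le_one fun v => ?_
  rw [one_mul]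
  exact (ContinuousLinearMap.opNorm_comp_le v _).trans
    (mul_le_of_le_one_right (norm_nonneg _) (ContinuousLinearMap.norm_inr_le_one ℝ ℝ E))

lemma RadialClass.partialSnd (h : RadialClass a Φ) : RadialClass (a + 1) (partialSnd Φ) :=
  h.clm_fderiv norm_compL_inr_le

lemma RadialClass.hasFDerivAt_snd (h : RadialClass a Φ) {ξ : E} (hξ : ξ ≠ 0) (r : ℝ) :
    HasFDerivAt (fun ξ => Φ (r, ξ)) (_root_.partialSnd Φ (r, ξ)) ξ :=
  (h.differentiableAt (q := (r, ξ)) hξ).hasFDerivAt.comp ξ (hasFDerivAt_prodMk_right r ξ)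

lemma RadialClass.continuous_fst (h : RadialClass a Φ) {ξ : E} (hξ : ξ ≠ 0) :
    Continuous fun r : ℝ => Φ (r, ξ) :=
  continuous_iff_continuousAt.2 fun r =>
    ((h.contDiffAt (q := (r, ξ)) hξ).continuousAt).comp (f := fun r : ℝ => (r, ξ)) (by fun_prop)

lemma RadialClass.zero_decay (h : RadialClass a Φ) (k : ℕ) : ∃ B : ℝ, ∀ (r : ℝ) (ω : E),
    ‖ω‖ = 1 → (1 + r ^ 2) ^ k * ‖Φ (r, ω)‖ ≤ B := by
  simpa using h.decay k 0

end Real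

variable {V : Type} [NormedAddCommGroup V] [NormedSpace ℂ V] {a N : ℕ} {Φ : ℝ × E → V}
  {g : ℝ → ℂ} {G B : ℝ}

/-- The weighted integral `∫ g(r) Φ(r, ξ) dr`. -/
def profileInt (g : ℝ → ℂ) (Φ : ℝ × E → V) (ξ : E) : V := ∫ r : ℝ, g r • Φ (r, ξ)

lemma RadialClass.norm_integrand_le (h : RadialClass a Φ) (hg : ∀ r, ‖g r‖ ≤ G * |r| ^ N)
    (hB : ∀ (r : ℝ) (ω : E), ‖ω‖ = 1 → (1 + r ^ 2) ^ (N + 1) * ‖Φ (r, ω)‖ ≤ B)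
    {l L : ℝ} (hl : 0 < l) {ξ : E} (h1 : l ≤ ‖ξ‖) (h2 : ‖ξ‖ ≤ L) (r : ℝ) :
    ‖g r • Φ (r, ξ)‖ ≤ G * B * (L ^ N * (l ^ a)⁻¹) * (1 + (r / L) ^ 2)⁻¹ := by
  have hn : 0 < ‖ξ‖ := hl.trans_le h1
  have hξ : ξ ≠ 0 := norm_pos_iff.1 hn
  have hL : 0 < L := hn.trans_le h2
  have hG : 0 ≤ G := by
    have := (norm_nonneg _).trans (hg 1)
    simpa using this
  have hB0 : 0 ≤ B := by
    have := hB 0 (‖ξ‖⁻¹ • ξ) (by simp [norm_smul, hn.ne'])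
    exact le_trans (by positivity) this
  have h3 := h.norm_le hB hξ r
  have h4 : |r| ^ N ≤ ‖ξ‖ ^ N * (1 + (r / ‖ξ‖) ^ 2) ^ N := by
    rw [← mul_pow]
    gcongr
    have : |r| = ‖ξ‖ * |r / ‖ξ‖| := by rw [abs_div, abs_norm]; field_simp
    rw [this]
    gcongr
    nlinarith [abs_nonneg (r / ‖ξ‖), sq_abs (r / ‖ξ‖), sq_nonneg (|r / ‖ξ‖| - 1)]
  rw [norm_smul]
  calc _ ≤ (G * (‖ξ‖ ^ N * (1 + (r / ‖ξ‖) ^ 2) ^ N)) *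
        ((‖ξ‖ ^ a)⁻¹ * B * ((1 + (r / ‖ξ‖) ^ 2) ^ (N + 1))⁻¹) :=
        mul_le_mul ((hg r).trans (mul_le_mul_of_nonneg_left h4 hG)) h3 (norm_nonneg _)
          (by positivity)
    _ = G * B * (‖ξ‖ ^ N * (‖ξ‖ ^ a)⁻¹) * (1 + (r / ‖ξ‖) ^ 2)⁻¹ := by
        have : (1 + (r / ‖ξ‖) ^ 2) ≠ 0 := by positivity
        generalize 1 + (r / ‖ξ‖) ^ 2 = x at this
        rw [pow_succ]
        field_simp
    _ ≤ _ := by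
        have : (r / L) ^ 2 ≤ (r / ‖ξ‖) ^ 2 := by
          rw [div_pow, div_pow]; gcongr
        gcongr

lemma integrable_inv_one_add_div_sq {L : ℝ} (hL : 0 < L) :
    Integrable fun r : ℝ => (1 + (r / L) ^ 2)⁻¹ :=
  integrable_inv_one_add_sq.comp_div hL.ne'

lemma RadialClass.aestronglyMeasurable (h : RadialClass a Φ) (hc : Continuous g) {ξ : E}
    (hξ : ξ ≠ 0) : AEStronglyMeasurable (fun r : ℝ => g r • Φ (r, ξ)) volume :=
  (hc.smul (h.continuous_fst hξ)).aestronglyMeasurable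

lemma RadialClass.integrable (h : RadialClass a Φ) (hc : Continuous g)
    (hg : ∀ r, ‖g r‖ ≤ G * |r| ^ N) {ξ : E} (hξ : ξ ≠ 0) :
    Integrable fun r : ℝ => g r • Φ (r, ξ) := by
  obtain ⟨B, hB⟩ := h.zero_decay (N + 1)
  have hn : 0 < ‖ξ‖ := norm_pos_iff.2 hξ
  exact Integrable.mono' ((integrable_inv_one_add_div_sq hn).const_mul
    (G * B * (‖ξ‖ ^ N * (‖ξ‖ ^ a)⁻¹))) (h.aestronglyMeasurable hc hξ)
    (ae_of_all _ (h.norm_integrand_le hg hB hn le_rfl le_rfl))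

lemma RadialClass.norm_profileInt_le (h : RadialClass a Φ) (hg : ∀ r, ‖g r‖ ≤ G * |r| ^ N)
    (hB : ∀ (r : ℝ) (ω : E), ‖ω‖ = 1 → (1 + r ^ 2) ^ (N + 1) * ‖Φ (r, ω)‖ ≤ B)
    {ξ : E} (hξ : ξ ≠ 0) :
    ‖ξ‖ ^ a * ‖profileInt g Φ ξ‖ ≤ π * G * B * ‖ξ‖ ^ (N + 1) := by
  have hn : 0 < ‖ξ‖ := norm_pos_iff.2 hξ
  have h1 : ‖profileInt g Φ ξ‖ ≤ _ := norm_integral_le_of_norm_le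
    ((integrable_inv_one_add_div_sq hn).const_mul (G * B * (‖ξ‖ ^ N * (‖ξ‖ ^ a)⁻¹)))
    (ae_of_all _ (h.norm_integrand_le hg hB hn le_rfl le_rfl))
  rw [integral_const_mul, Measure.integral_comp_div (fun r => (1 + r ^ 2)⁻¹),
    integral_univ_inv_one_add_sq, abs_norm, smul_eq_mul] at h1
  calc _ ≤ ‖ξ‖ ^ a * (G * B * (‖ξ‖ ^ N * (‖ξ‖ ^ a)⁻¹) * (‖ξ‖ * π)) := by gcongr
    _ = _ := by field_simp; ring

lemma RadialClass.hasFDerivAt_profileInt (h : RadialClass a Φ) (hc : Continuous g)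
    (hg : ∀ r, ‖g r‖ ≤ G * |r| ^ N) {ξ : E} (hξ : ξ ≠ 0) :
    HasFDerivAt (profileInt g Φ) (profileInt g (_root_.partialSnd Φ) ξ) ξ := by
  have hn : 0 < ‖ξ‖ := norm_pos_iff.2 hξ
  have hs : {x : E | ‖ξ‖ / 2 < ‖x‖ ∧ ‖x‖ < 2 * ‖ξ‖} ∈ 𝓝 ξ :=
    ((isOpen_lt continuous_const continuous_norm).inter
      (isOpen_lt continuous_norm continuous_const)).mem_nhds ⟨by simp [hn], by simp [hn]⟩
  have hl : 0 < ‖ξ‖ / 2 := by positivity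
  obtain ⟨B, hB⟩ := h.partialSnd.zero_decay (N + 1)
  refine hasFDerivAt_integral_of_dominated_of_fderiv_le (𝕜 := ℝ) (μ := volume)
    (F := fun (ξ : E) (r : ℝ) => g r • Φ (r, ξ))
    (F' := fun ξ r => g r • _root_.partialSnd Φ (r, ξ))
    (bound := fun r => G * B * ((2 * ‖ξ‖) ^ N * ((‖ξ‖ / 2) ^ (a + 1))⁻¹) *
      (1 + (r / (2 * ‖ξ‖)) ^ 2)⁻¹) hs ?_ (h.integrable hc hg hξ)
    (h.partialSnd.aestronglyMeasurable hc hξ) ?_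
    ((integrable_inv_one_add_div_sq (by positivity)).const_mul _) ?_
  · exact Filter.eventually_of_mem hs fun x hx => h.aestronglyMeasurable hc
      (norm_pos_iff.1 (hl.trans hx.1))
  · exact ae_of_all _ fun r x hx =>
      h.partialSnd.norm_integrand_le hg hB hl hx.1.le hx.2.le r
  · exact ae_of_all _ fun r x hx =>
      (h.hasFDerivAt_snd (norm_pos_iff.1 (hl.trans hx.1)) r).const_smul (g r)

lemma contDiffOn_profileInt_nat (hc : Continuous g) (hg : ∀ r, ‖g r‖ ≤ G * |r| ^ N) (m : ℕ) :
    ∀ (V : Type) [NormedAddCommGroup V] [NormedSpace ℂ V] (a : ℕ)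
      (Φ : ℝ × E → V), RadialClass a Φ → ContDiffOn ℝ m (profileInt g Φ) {ξ | ξ ≠ 0} := by
  induction m with
  | zero =>
    intro V _ _ a Φ h
    exact contDiffOn_zero.2 fun q hq =>
      (h.hasFDerivAt_profileInt hc hg hq).continuousAt.continuousWithinAt
  | succ m ih =>
    intro V _ _ a Φ h
    push_cast
    rw [contDiffOn_succ_iff_fderiv_of_isOpen isOpen_ne]
    refine ⟨fun q hq => (h.hasFDerivAt_profileInt hc hg hq).differentiableAt.differentiableWithinAt,
      by simp, ?_⟩
    exact (ih _ (a + 1) _ h.partialSnd).congr fun q hq => (h.hasFDerivAt_profileInt hc hg hq).fderiv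

lemma RadialClass.contDiffOn_profileInt (h : RadialClass a Φ) (hc : Continuous g)
    (hg : ∀ r, ‖g r‖ ≤ G * |r| ^ N) :
    ContDiffOn ℝ (⊤ : ℕ∞) (profileInt g Φ) {ξ | ξ ≠ 0} :=
  contDiffOn_infty.2 fun m => contDiffOn_profileInt_nat hc hg m V a Φ h

lemma norm_iteratedFDeriv_profileInt_le (hc : Continuous g) (hg : ∀ r, ‖g r‖ ≤ G * |r| ^ N)
    (m : ℕ) : ∀ (V : Type) [NormedAddCommGroup V] [NormedSpace ℂ V] (a : ℕ)
      (Φ : ℝ × E → V) (B : ℝ), RadialClass a Φ →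
      (∀ (r : ℝ) (ω : E), ‖ω‖ = 1 → (1 + r ^ 2) ^ (N + 1) * ‖iteratedFDeriv ℝ m Φ (r, ω)‖ ≤ B) →
      ∀ ξ : E, ξ ≠ 0 → ‖ξ‖ ^ (a + m) * ‖iteratedFDeriv ℝ m (profileInt g Φ) ξ‖ ≤
        π * G * B * ‖ξ‖ ^ (N + 1) := by
  induction m with
  | zero =>
    intro V _ _ a Φ B h hB ξ hξ
    simp only [norm_iteratedFDeriv_zero] at hB ⊢
    exact h.norm_profileInt_le hg hB hξ
  | succ m ih =>
    intro V _ _ a Φ B h hB ξ hξ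
    have e : fderiv ℝ (profileInt g Φ) =ᶠ[𝓝 ξ] profileInt g (partialSnd Φ) :=
      Filter.eventually_of_mem (isOpen_ne.mem_nhds hξ) fun q hq =>
        (h.hasFDerivAt_profileInt hc hg hq).fderiv
    rw [← norm_iteratedFDeriv_fderiv, (e.iteratedFDeriv ℝ m).eq_of_nhds,
      show a + (m + 1) = a + 1 + m by ring]
    refine ih _ (a + 1) _ B h.partialSnd (fun r ω hω => le_trans ?_ (hB r ω hω)) ξ hξ
    have := norm_iteratedFDeriv_clm_fderiv_le h.smooth (norm_compL_inr_le (E := E) (V := V)) m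
      (q := (r, ω)) (mem_punctured.1 (mem_punctured_of_norm_eq_one hω))
    exact mul_le_mul_of_nonneg_left this (by positivity)

/-- The derivative `(2πi)⁻¹ ∂Φ/∂r`. -/
def partialFst (Φ : ℝ × E → V) (q : ℝ × E) : V :=
  ((2 * π * I : ℂ)⁻¹ • ContinuousLinearMap.apply ℝ V ((1, 0) : ℝ × E)) (fderiv ℝ Φ q)

lemma norm_smul_apply_le : ‖((2 * π * I : ℂ)⁻¹ • ContinuousLinearMap.apply ℝ V ((1, 0) : ℝ × E))‖
    ≤ 1 := by
  refine ContinuousLinearMap.opNorm_le_bound _ zero_le_one fun v => ?_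
  have hv : ‖v ((1, 0) : ℝ × E)‖ ≤ ‖v‖ := by simpa using v.le_opNorm ((1, 0) : ℝ × E)
  have h2 : ‖(2 * π * I : ℂ)⁻¹‖ ≤ 1 := by
    rw [norm_inv]
    refine inv_le_one_of_one_le₀ ?_
    simp only [norm_mul, Complex.norm_ofNat, Complex.norm_real, norm_I, mul_one, Real.norm_eq_abs,
      abs_of_pos Real.pi_pos]
    linarith [Real.pi_gt_three]
  simp only [FunLike.coe_smul, Pi.smul_apply, ContinuousLinearMap.apply_apply, norm_smul]
  gcongr

lemma RadialClass.profileInt_partialFst (h : RadialClass a Φ) {ξ : E} (hξ : ξ ≠ 0) :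
    profileInt (fun r => waveKernel (-1) r) Φ ξ =
      profileInt (fun r => waveKernel (-1) r) (_root_.partialFst Φ) ξ := by
  have hc : Continuous fun r => waveKernel (-1) r :=
    continuous_waveKernel.comp (by fun_prop : Continuous fun r : ℝ => ((-1 : ℝ), r))
  have hg : ∀ r, ‖waveKernel (-1) r‖ ≤ 1 * |r| ^ 0 := fun r => by simp [norm_waveKernel]
  have i1 := h.integrable hc hg hξ
  have i2 := (h.clm_fderiv (norm_smul_apply_le (E := E) (V := V))).integrable hc hg hξ
  have hpi : (2 * π * I : ℂ) ≠ 0 := by simp [Real.pi_ne_zero]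
  have hd (r : ℝ) : HasDerivAt (fun r => (2 * π * I : ℂ)⁻¹ • waveKernel (-1) r • Φ (r, ξ))
      (waveKernel (-1) r • _root_.partialFst Φ (r, ξ) - waveKernel (-1) r • Φ (r, ξ)) r := by
    have h1 := hasDerivAt_waveKernel_left r (-1)
    simp only [waveKernel_comm _ (-1)] at h1
    have h2 : HasDerivAt (fun r : ℝ => Φ (r, ξ)) (fderiv ℝ Φ (r, ξ) (1, 0)) r :=
      (h.differentiableAt (q := (r, ξ)) hξ).hasFDerivAt.comp_hasDerivAt r
        ((hasDerivAt_id r).prodMk (hasDerivAt_const r ξ))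
    refine ((h1.smul h2).const_smul (2 * π * I : ℂ)⁻¹).congr_deriv ?_
    simp only [_root_.partialFst, FunLike.coe_smul, Pi.smul_apply,
      ContinuousLinearMap.apply_apply]
    rw [smul_add, sub_eq_add_neg]
    congr 1
    · module
    · rw [smul_smul, ← neg_smul]
      congr 1
      push_cast
      field_simp
  have := integral_eq_zero_of_hasDerivAt_of_integrable hd (i2.sub i1)
    (i1.smul (2 * π * I : ℂ)⁻¹)
  rw [integral_sub (by exact i2) i1] at this
  exact (sub_eq_zero.1 this).symm

lemma pow_mul_norm_iteratedFDeriv_profileInt_le (m : ℕ) (K : ℕ) : ∀ (a : ℕ)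
      (Φ : ℝ × E → V) (B : ℝ), RadialClass a Φ →
      (∀ (r : ℝ) (ω : E), ‖ω‖ = 1 → (1 + r ^ 2) * ‖iteratedFDeriv ℝ (m + K) Φ (r, ω)‖ ≤ B) →
      ∀ ξ : E, ξ ≠ 0 → ‖ξ‖ ^ (a + K + m) *
        ‖iteratedFDeriv ℝ m (profileInt (fun r => waveKernel (-1) r) Φ) ξ‖ ≤ π * B * ‖ξ‖ := by
  induction K with
  | zero =>
    intro a Φ B h hB ξ hξ
    have hc : Continuous fun r => waveKernel (-1) r :=
      continuous_waveKernel.comp (by fun_prop : Continuous fun r : ℝ => ((-1 : ℝ), r))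
    have hg : ∀ r, ‖waveKernel (-1) r‖ ≤ 1 * |r| ^ 0 := fun r => by simp [norm_waveKernel]
    simpa using norm_iteratedFDeriv_profileInt_le hc hg m V a Φ B h (by simpa using hB) ξ hξ
  | succ K ih =>
    intro a Φ B h hB ξ hξ
    have e : profileInt (fun r => waveKernel (-1) r) Φ =ᶠ[𝓝 ξ]
        profileInt (fun r => waveKernel (-1) r) (partialFst Φ) :=
      Filter.eventually_of_mem (isOpen_ne.mem_nhds hξ) fun q hq => h.profileInt_partialFst hq
    rw [(e.iteratedFDeriv ℝ m).eq_of_nhds, show a + (K + 1) + m = a + 1 + K + m by ring]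
    refine ih (a + 1) _ B (h.clm_fderiv norm_smul_apply_le)
      (fun r ω hω => le_trans ?_ (hB r ω hω)) ξ hξ
    have := norm_iteratedFDeriv_clm_fderiv_le h.smooth (norm_smul_apply_le (E := E) (V := V))
      (m + K) (q := (r, ω)) (mem_punctured.1 (mem_punctured_of_norm_eq_one hω))
    exact mul_le_mul_of_nonneg_left this (by positivity)

end Profile

section Extension

/-- The Taylor remainder of order `N` of `r ↦ e^{-2πir}`. -/
def waveRemainder (N : ℕ) (r : ℝ) : ℂ :=
  waveKernel (-1) r - ∑ k ∈ range N, ((-(2 * π * I)) ^ k / k.factorial) * (r : ℂ) ^ k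

lemma continuous_waveKernel_right (s : ℝ) : Continuous fun r => waveKernel s r :=
  continuous_waveKernel.comp (by fun_prop : Continuous fun r : ℝ => (s, r))

lemma norm_waveKernel_le_pow_zero (s r : ℝ) : ‖waveKernel s r‖ ≤ 1 * |r| ^ 0 := by
  simp [norm_waveKernel]

lemma continuous_waveRemainder (N : ℕ) : Continuous (waveRemainder N) := by
  unfold waveRemainder
  exact (continuous_waveKernel_right _).sub (by fun_prop)

lemma norm_exp_sub_taylor_le {z : ℂ} (hz : ‖cexp z‖ ≤ 1) (N : ℕ) :
    ‖cexp z - ∑ k ∈ range N, z ^ k / k.factorial‖ ≤ (2 + N) * (2 * ‖z‖) ^ N := by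
  rcases le_or_gt ‖z‖ (1 / 2) with h | h
  · have h1 : ‖z‖ / N.succ ≤ 1 / 2 :=
      (div_le_self (norm_nonneg _) (by exact_mod_cast Nat.succ_pos N)).trans h
    refine (Complex.exp_bound' h1).trans ?_
    have h2 : ‖z‖ ^ N / N.factorial ≤ (2 * ‖z‖) ^ N := by
      refine (div_le_self (by positivity) (by exact_mod_cast Nat.factorial_pos N)).trans ?_
      gcongr
      linarith [norm_nonneg z]
    have h3 : 0 ≤ (N : ℝ) * (2 * ‖z‖) ^ N := by positivity
    linarith
  · have h1 : 1 ≤ 2 * ‖z‖ := by linarith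
    have h2 : ∀ k ∈ range N, ‖z ^ k / k.factorial‖ ≤ (2 * ‖z‖) ^ N := fun k hk => by
      rw [norm_div, norm_pow, Complex.norm_natCast]
      refine (div_le_self (by positivity) (by exact_mod_cast Nat.factorial_pos k)).trans ?_
      refine le_trans ?_ (pow_le_pow_right₀ h1 (mem_range.1 hk).le)
      gcongr
      linarith [norm_nonneg z]
    have h3 := (norm_sum_le (range N) fun k => z ^ k / (k.factorial : ℂ)).trans
      (sum_le_card_nsmul _ _ _ h2)
    have h4 : 1 ≤ (2 * ‖z‖) ^ N := one_le_pow₀ h1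
    simp only [card_range, nsmul_eq_mul] at h3
    refine (norm_sub_le _ _).trans ?_
    linarith

lemma exists_norm_waveRemainder_le (N : ℕ) :
    ∃ G : ℝ, 0 ≤ G ∧ ∀ r, ‖waveRemainder N r‖ ≤ G * |r| ^ N := by
  refine ⟨(2 + N) * (2 * (2 * π)) ^ N, by positivity, fun r => ?_⟩
  have h := norm_exp_sub_taylor_le (z := 2 * π * I * ((-1 : ℝ) * r)) (norm_waveKernel (-1) r).le N
  have hz : ‖(2 * π * I * ((-1 : ℝ) * r) : ℂ)‖ = 2 * π * |r| := by
    simp [abs_of_pos Real.pi_pos]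
  rw [hz, ← mul_assoc 2 (2 * π), mul_pow] at h
  rw [mul_assoc]
  refine le_of_eq_of_le ?_ h
  unfold waveRemainder waveKernel
  congr 2
  refine sum_congr rfl fun k _ => ?_
  rw [show (2 * π * I * ((-1 : ℝ) * r) : ℂ) = -(2 * π * I) * r by push_cast; ring, mul_pow]
  ring

variable {E : Type} [NormedAddCommGroup E] [NormedSpace ℝ E]

lemma contDiff_of_flat_at_zero (M : ℕ) : ∀ (V : Type) [NormedAddCommGroup V] [NormedSpace ℝ V]
    (h : E → V) (C : ℝ), ContDiffOn ℝ (⊤ : ℕ∞) h {ξ | ξ ≠ 0} → h 0 = 0 →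
    (∀ m ≤ M, ∀ ξ : E, ξ ≠ 0 → ‖ξ‖ ≤ 1 → ‖iteratedFDeriv ℝ m h ξ‖ ≤ C * ‖ξ‖ ^ 2) →
    ContDiff ℝ M h := by
  have flat (V : Type) [NormedAddCommGroup V] [NormedSpace ℝ V] (h : E → V) (C : ℝ) (h0 : h 0 = 0)
      (hb : ∀ ξ : E, ξ ≠ 0 → ‖ξ‖ ≤ 1 → ‖iteratedFDeriv ℝ 0 h ξ‖ ≤ C * ‖ξ‖ ^ 2) :
      HasFDerivAt h (0 : E →L[ℝ] V) 0 := by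
    refine Asymptotics.IsBigO.hasFDerivAt (n := 2) (Asymptotics.IsBigO.of_bound C ?_) one_lt_two
    filter_upwards [Metric.closedBall_mem_nhds (0 : E) one_pos] with ξ hξ
    rcases eq_or_ne ξ 0 with rfl | hne
    · simp [h0]
    · simpa using hb ξ hne (by simpa using hξ)
  induction M with
  | zero =>
    intro V _ _ h C hs h0 hb
    refine contDiff_zero.2 (continuous_iff_continuousAt.2 fun ξ => ?_)
    rcases eq_or_ne ξ 0 with rfl | hne
    · exact (flat V h C h0 (hb 0 le_rfl)).continuousAt
    · exact (hs.contDiffAt (isOpen_ne.mem_nhds hne)).continuousAt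
  | succ M ih =>
    intro V _ _ h C hs h0 hb
    have hf := flat V h C h0 (hb 0 (Nat.zero_le _))
    push_cast
    rw [contDiff_succ_iff_fderiv]
    refine ⟨fun ξ => ?_, by simp, ?_⟩
    · rcases eq_or_ne ξ 0 with rfl | hne
      · exact hf.differentiableAt
      · exact (hs.contDiffAt (isOpen_ne.mem_nhds hne)).differentiableAt (by simp)
    · refine ih _ (fderiv ℝ h) C ((contDiffOn_infty_iff_fderiv_of_isOpen isOpen_ne).1 hs).2
        hf.fderiv fun m hm ξ hne hξ => ?_
      rw [norm_iteratedFDeriv_fderiv]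
      exact hb (m + 1) (by omega) ξ hne hξ

variable {V : Type} [NormedAddCommGroup V]

lemma iteratedFDeriv_eq_zero_of_homogeneous [NormedSpace ℝ V] {Q : E → V}
    (hQ : ContDiff ℝ (⊤ : ℕ∞) Q) {k M : ℕ} (hkM : k < M)
    (hh : ∀ (t : ℝ) (ξ : E), Q (t • ξ) = t ^ k • Q ξ) (ξ : E) : iteratedFDeriv ℝ M Q ξ = 0 := by
  have hQM : ContDiff ℝ M Q := hQ.of_le (natCast_le_infty M)
  have h1 (t : ℝ) (ht : 0 < t) :
      iteratedFDeriv ℝ M Q ξ = t ^ (M - k) • iteratedFDeriv ℝ M Q (t • ξ) := by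
    have e1 := congrFun (iteratedFDeriv_comp_const_smul (i := M) t hQM) ξ
    have e2 : (fun z => Q (t • z)) = t ^ k • Q := funext fun z => hh t z
    rw [e2, iteratedFDeriv_const_smul_apply hQM.contDiffAt] at e1
    have : t ^ M = t ^ k * t ^ (M - k) := by rw [← pow_add]; congr 1; omega
    rw [this, mul_smul] at e1
    exact smul_right_injective _ (pow_pos ht k).ne' e1
  have hc : Continuous fun t : ℝ => t ^ (M - k) • iteratedFDeriv ℝ M Q (t • ξ) := by
    have := (hQM.continuous_iteratedFDeriv (m := M) le_rfl).comp
      (by fun_prop : Continuous fun t : ℝ => t • ξ)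
    exact (continuous_pow _).smul this
  have h2 := (hc.tendsto 0).mono_left (nhdsWithin_le_nhds (s := Set.Ioi 0))
  rw [zero_pow (by omega), zero_smul] at h2
  refine tendsto_nhds_unique (tendsto_const_nhds.congr' ?_) h2
  exact Filter.eventually_of_mem self_mem_nhdsWithin h1

variable [NormedSpace ℂ V]

/-- The family `Q` gives the moments of `Φ` in the first variable; they are smooth and
homogeneous, i.e. polynomial. -/
structure HasMoments (Φ : ℝ × E → V) (Q : ℕ → E → V) : Prop where
  smooth : ∀ k, ContDiff ℝ (⊤ : ℕ∞) (Q k)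
  homog : ∀ (k : ℕ) (t : ℝ) (ξ : E), Q k (t • ξ) = t ^ k • Q k ξ
  moment : ∀ (k : ℕ) (ξ : E), ξ ≠ 0 → ∫ r : ℝ, (r : ℂ) ^ k • Φ (r, ξ) = Q k ξ

variable {Φ : ℝ × E → V} {Q : ℕ → E → V} {a : ℕ}

/-- The Taylor polynomial of the Fourier transform built from the moments. -/
def momentSum (Q : ℕ → E → V) (N : ℕ) (ξ : E) : V :=
  ∑ k ∈ range N, ((-(2 * π * I)) ^ k / k.factorial : ℂ) • Q k ξ

lemma HasMoments.contDiff_momentSum (hQ : HasMoments Φ Q) (N : ℕ) :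
    ContDiff ℝ (⊤ : ℕ∞) (momentSum Q N) :=
  ContDiff.sum fun k _ => (hQ.smooth k).const_smul _

lemma HasMoments.iteratedFDeriv_momentSum (hQ : HasMoments Φ Q) (N : ℕ) (ξ : E) :
    iteratedFDeriv ℝ N (momentSum Q N) ξ = 0 := by
  unfold momentSum
  have hs (k : ℕ) : ContDiff ℝ (⊤ : ℕ∞) fun ξ => ((-(2 * π * I)) ^ k / k.factorial : ℂ) • Q k ξ :=
    (hQ.smooth k).const_smul _
  rw [iteratedFDeriv_fun_sum_apply fun k _ => ((hs k).of_le (natCast_le_infty N)).contDiffAt]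
  refine sum_eq_zero fun k hk => ?_
  refine iteratedFDeriv_eq_zero_of_homogeneous (hs k) (mem_range.1 hk) (fun t ξ => ?_) ξ
  rw [hQ.homog, smul_comm]

lemma HasMoments.profileInt_eq (hQ : HasMoments Φ Q) (h : RadialClass a Φ) (N : ℕ) {ξ : E}
    (hξ : ξ ≠ 0) : profileInt (fun r => waveKernel (-1) r) Φ ξ =
      momentSum Q N ξ + profileInt (waveRemainder N) Φ ξ := by
  have i1 := h.integrable (continuous_waveKernel_right (-1)) (norm_waveKernel_le_pow_zero (-1)) hξ
  have i2 (k : ℕ) : Integrable fun r : ℝ =>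
      ((-(2 * π * I)) ^ k / k.factorial : ℂ) • (r : ℂ) ^ k • Φ (r, ξ) :=
    (h.integrable (g := fun r : ℝ => (r : ℂ) ^ k) (N := k) (G := 1) (by fun_prop) (by simp)
      hξ).smul _
  have e : profileInt (waveRemainder N) Φ ξ = ∫ r : ℝ, (waveKernel (-1) r • Φ (r, ξ) -
      ∑ k ∈ range N, ((-(2 * π * I)) ^ k / k.factorial : ℂ) • (r : ℂ) ^ k • Φ (r, ξ)) := by
    refine integral_congr_ae (ae_of_all _ fun r => ?_)
    simp only [waveRemainder, sub_smul, sum_smul, smul_smul]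
  rw [e, integral_sub i1 (integrable_finsetSum _ fun k _ => i2 k),
    integral_finsetSum _ fun k _ => i2 k]
  simp only [integral_smul, hQ.moment _ ξ hξ, momentSum, profileInt]
  abel

lemma HasMoments.iteratedFDeriv_profileInt (hQ : HasMoments Φ Q) (h : RadialClass a Φ) (N : ℕ)
    {ξ : E} (hξ : ξ ≠ 0) : iteratedFDeriv ℝ N (profileInt (fun r => waveKernel (-1) r) Φ) ξ =
      iteratedFDeriv ℝ N (profileInt (waveRemainder N) Φ) ξ := by
  obtain ⟨G, -, hG⟩ := exists_norm_waveRemainder_le N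
  have e : profileInt (fun r => waveKernel (-1) r) Φ =ᶠ[𝓝 ξ]
      momentSum Q N + profileInt (waveRemainder N) Φ :=
    Filter.eventually_of_mem (isOpen_ne.mem_nhds hξ) fun q hq => hQ.profileInt_eq h N hq
  have c1 := (h.contDiffOn_profileInt (continuous_waveRemainder N) hG).contDiffAt
    (isOpen_ne.mem_nhds hξ)
  rw [(e.iteratedFDeriv ℝ N).eq_of_nhds, iteratedFDeriv_add_apply
    ((hQ.contDiff_momentSum N).of_le (natCast_le_infty N)).contDiffAt
    (c1.of_le (natCast_le_infty N)), hQ.iteratedFDeriv_momentSum, zero_add]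

lemma exists_pow_mul_norm_iteratedFDeriv_fourier_le (K M : ℕ) : ∃ C : ℝ, 0 ≤ C ∧
    ∀ (V : Type) [NormedAddCommGroup V] [NormedSpace ℂ V] (Φ : ℝ × E → V) (Q : ℕ → E → V) (B : ℝ),
      RadialClass 1 Φ → HasMoments Φ Q →
      (∀ (r : ℝ) (ω : E), ‖ω‖ = 1 → (1 + r ^ 2) ^ (M + 1) * ‖iteratedFDeriv ℝ M Φ (r, ω)‖ ≤ B) →
      (∀ (r : ℝ) (ω : E), ‖ω‖ = 1 → (1 + r ^ 2) * ‖iteratedFDeriv ℝ (M + K) Φ (r, ω)‖ ≤ B) →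
      ∀ ξ : E, ξ ≠ 0 →
        ‖ξ‖ ^ K * ‖iteratedFDeriv ℝ M (profileInt (fun r => waveKernel (-1) r) Φ) ξ‖ ≤ C * B := by
  obtain ⟨G, hG0, hG⟩ := exists_norm_waveRemainder_le M
  refine ⟨π * G + π, by positivity, fun V _ _ Φ Q B h hQ hB1 hB2 ξ hξ => ?_⟩
  have hn : 0 < ‖ξ‖ := norm_pos_iff.2 hξ
  have hB0 : 0 ≤ B := by
    have := hB2 0 (‖ξ‖⁻¹ • ξ) (by simp [norm_smul, hn.ne'])
    exact le_trans (by positivity) this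
  have hπB : 0 ≤ π * B := by positivity
  have hπGB : 0 ≤ π * G * B := by positivity
  rcases le_total ‖ξ‖ 1 with hle | hge
  · have h1 := norm_iteratedFDeriv_profileInt_le (continuous_waveRemainder M) hG M V 1 Φ B h hB1 ξ hξ
    rw [← hQ.iteratedFDeriv_profileInt h M hξ, add_comm 1 M, mul_comm] at h1
    have h2 := le_of_mul_le_mul_right h1 (by positivity)
    have h3 : ‖ξ‖ ^ K ≤ 1 := pow_le_one₀ hn.le hle
    refine (mul_le_of_le_one_left (norm_nonneg _) h3).trans ?_
    linarith
  · have h1 := pow_mul_norm_iteratedFDeriv_profileInt_le M K 1 Φ B h hB2 ξ hξ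
    rw [show 1 + K + M = K + M + 1 by ring, pow_succ, mul_right_comm] at h1
    have h2 := le_of_mul_le_mul_right h1 hn
    rw [pow_add, mul_right_comm] at h2
    have h3 : 1 ≤ ‖ξ‖ ^ M := one_le_pow₀ hge
    have h4 := le_mul_of_one_le_right (show 0 ≤ ‖ξ‖ ^ K *
      ‖iteratedFDeriv ℝ M (profileInt (fun r => waveKernel (-1) r) Φ) ξ‖ by positivity) h3
    linarith

lemma HasMoments.contDiff (hQ : HasMoments Φ Q) (h : RadialClass 1 Φ) {F : E → V}
    (hF : ∀ ξ, ξ ≠ 0 → F ξ = profileInt (fun r => waveKernel (-1) r) Φ ξ) (hF0 : F 0 = Q 0 0) :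
    ContDiff ℝ (⊤ : ℕ∞) F := by
  refine contDiff_infty.2 fun M => ?_
  obtain ⟨G, hG0, hG⟩ := exists_norm_waveRemainder_le (M + 2)
  set R : E → V := fun ξ => F ξ - momentSum Q (M + 2) ξ with hR
  have hRξ : ∀ ξ : E, ξ ≠ 0 → R ξ = profileInt (waveRemainder (M + 2)) Φ ξ := fun ξ hξ => by
    rw [hR]
    simp only
    rw [hF ξ hξ, hQ.profileInt_eq h (M + 2) hξ, add_sub_cancel_left]
  have hR0 : R 0 = 0 := by
    have hz : ∀ k, k ≠ 0 → Q k 0 = 0 := fun k hk => by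
      have := hQ.homog k 0 0
      rwa [smul_zero, zero_pow hk, zero_smul] at this
    have : momentSum Q (M + 2) 0 = Q 0 0 := by
      unfold momentSum
      rw [sum_range_succ', sum_eq_zero fun k _ => by rw [hz (k + 1) (by omega), smul_zero]]
      simp
    rw [hR]
    simp [this, hF0]
  have hsR := h.contDiffOn_profileInt (continuous_waveRemainder (M + 2)) hG
  choose B hB using fun m => h.decay (M + 2 + 1) m
  have key : ContDiff ℝ M R := by
    refine contDiff_of_flat_at_zero M V R (∑ m ∈ range (M + 1), π * G * |B m|)
      (hsR.congr fun ξ hξ => hRξ ξ hξ) hR0 fun m hm ξ hξ hle => ?_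
    have e : R =ᶠ[𝓝 ξ] profileInt (waveRemainder (M + 2)) Φ :=
      Filter.eventually_of_mem (isOpen_ne.mem_nhds hξ) hRξ
    have hn : 0 < ‖ξ‖ := norm_pos_iff.2 hξ
    have h1 := norm_iteratedFDeriv_profileInt_le (continuous_waveRemainder (M + 2)) hG m V 1 Φ
      (|B m|) h (fun r ω hω => (hB m r ω hω).trans (le_abs_self _)) ξ hξ
    rw [(e.iteratedFDeriv ℝ m).eq_of_nhds]
    have h2 : ‖ξ‖ ^ (M + 2 + 1) = ‖ξ‖ ^ (1 + m) * (‖ξ‖ ^ (M - m) * ‖ξ‖ ^ 2) := by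
      rw [← pow_add, ← pow_add]; congr 1; omega
    rw [h2, mul_left_comm] at h1
    have h3 := le_of_mul_le_mul_left h1 (by positivity)
    have h4 : ‖ξ‖ ^ (M - m) ≤ 1 := pow_le_one₀ hn.le hle
    have h5 : π * G * |B m| ≤ ∑ m ∈ range (M + 1), π * G * |B m| :=
      single_le_sum (f := fun m => π * G * |B m|) (fun _ _ => by positivity)
        (mem_range.2 (by omega))
    refine h3.trans ?_
    refine mul_le_mul h5 (mul_le_of_le_one_left (by positivity) h4) (by positivity) ?_
    exact sum_nonneg fun _ _ => by positivity
  have : F = fun ξ => R ξ + momentSum Q (M + 2) ξ := funext fun ξ => by simp [hR]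
  rw [this]
  exact key.add ((hQ.contDiff_momentSum _).of_le (natCast_le_infty M))

lemma forall_pow_mul_norm_iteratedFDeriv_le [Nontrivial E] {F : E → V}
    (hF : ContDiff ℝ (⊤ : ℕ∞) F)
    (hFΦ : ∀ ξ, ξ ≠ 0 → F ξ = profileInt (fun r => waveKernel (-1) r) Φ ξ) {K M : ℕ} {B : ℝ}
    (hB : ∀ ξ : E, ξ ≠ 0 →
        ‖ξ‖ ^ K * ‖iteratedFDeriv ℝ M (profileInt (fun r => waveKernel (-1) r) Φ) ξ‖ ≤ B) (ξ : E) :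
    ‖ξ‖ ^ K * ‖iteratedFDeriv ℝ M F ξ‖ ≤ B := by
  have hc : Continuous fun ξ => ‖ξ‖ ^ K * ‖iteratedFDeriv ℝ M F ξ‖ :=
    (continuous_norm.pow K).mul (hF.continuous_iteratedFDeriv (natCast_le_infty M)).norm
  have hcl : IsClosed {ξ | ‖ξ‖ ^ K * ‖iteratedFDeriv ℝ M F ξ‖ ≤ B} :=
    isClosed_le hc continuous_const
  have hd : Dense ({0}ᶜ : Set E) := by
    have := Module.punctured_nhds_neBot ℝ E 0
    exact dense_compl_singleton 0
  have : closure ({0}ᶜ : Set E) ⊆ {ξ | ‖ξ‖ ^ K * ‖iteratedFDeriv ℝ M F ξ‖ ≤ B} := by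
    refine closure_minimal (fun ξ hξ => ?_) hcl
    have hξ : ξ ≠ 0 := hξ
    have e : F =ᶠ[𝓝 ξ] profileInt (fun r => waveKernel (-1) r) Φ :=
      Filter.eventually_of_mem (isOpen_ne.mem_nhds hξ) hFΦ
    rw [Set.mem_ofPred_eq, (e.iteratedFDeriv ℝ M).eq_of_nhds]
    exact hB ξ hξ
  exact this (hd ξ)

lemma HasMoments.exists_schwartz [Nontrivial E] (hQ : HasMoments Φ Q) (h : RadialClass 1 Φ) :
    ∃ F : 𝓢(E, V), ∀ ξ, ξ ≠ 0 → F ξ = profileInt (fun r => waveKernel (-1) r) Φ ξ := by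
  classical
  set F : E → V := fun ξ => if ξ = 0 then Q 0 0 else profileInt (fun r => waveKernel (-1) r) Φ ξ
  have hF : ∀ ξ, ξ ≠ 0 → F ξ = profileInt (fun r => waveKernel (-1) r) Φ ξ :=
    fun ξ hξ => if_neg hξ
  have hs : ContDiff ℝ (⊤ : ℕ∞) F := hQ.contDiff h hF (if_pos rfl)
  refine ⟨⟨F, hs, fun K M => ?_⟩, hF⟩
  obtain ⟨C, -, hC⟩ := exists_pow_mul_norm_iteratedFDeriv_fourier_le (E := E) K M
  obtain ⟨B₁, hB₁⟩ := h.decay (M + 1) M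
  obtain ⟨B₂, hB₂⟩ := h.decay 1 (M + K)
  simp only [pow_one] at hB₂
  exact ⟨_, forall_pow_mul_norm_iteratedFDeriv_le hs hF (hC V Φ Q (max B₁ B₂) h hQ
    (fun r ω hω => (hB₁ r ω hω).trans (le_max_left _ _))
    (fun r ω hω => (hB₂ r ω hω).trans (le_max_right _ _)))⟩

end Extension

section Backward

variable {φ : ℝ × EuclideanSpace ℝ (Fin n) → ℂ}

lemma IsSH.contDiffOn (h : IsSH φ) : ContDiffOn ℝ (⊤ : ℕ∞) φ (punctured _) := h.2.2.1

lemma iteratedFDerivWithin_punctured {E : Type} [NormedAddCommGroup E] [NormedSpace ℝ E]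
    {V : Type} [NormedAddCommGroup V] [NormedSpace ℝ V]
    (m : ℕ) (Φ : ℝ × E → V) (r : ℝ) {ω : E} (hω : ‖ω‖ = 1) :
    iteratedFDerivWithin ℝ m Φ (Set.univ ×ˢ {x : E | x ≠ 0}) (r, ω) =
      iteratedFDeriv ℝ m Φ (r, ω) :=
  iteratedFDerivWithin_of_isOpen m isOpen_punctured (mem_punctured_of_norm_eq_one hω)

lemma etaSemi_nonneg (k m : ℕ) (φ : ℝ × EuclideanSpace ℝ (Fin n) → ℂ) : 0 ≤ etaSemi k m φ :=
  Real.iSup_nonneg fun _ => Real.iSup_nonneg fun _ => Real.iSup_nonneg fun _ => by positivity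

lemma etaSemi_le {k m : ℕ} {C : ℝ} (hC : 0 ≤ C)
    (h : ∀ (r : ℝ) (ω : EuclideanSpace ℝ (Fin n)), ‖ω‖ = 1 →
      (1 + r ^ 2) ^ k * ‖iteratedFDeriv ℝ m φ (r, ω)‖ ≤ C) : etaSemi k m φ ≤ C := by
  refine Real.iSup_le (fun r => Real.iSup_le (fun ω => Real.iSup_le (fun hω => ?_) hC) hC) hC
  rw [iteratedFDerivWithin_punctured m φ r hω]
  exact h r ω hω

lemma IsSH.le_etaSemi (h : IsSH φ) (k m : ℕ) (r : ℝ) {ω : EuclideanSpace ℝ (Fin n)}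
    (hω : ‖ω‖ = 1) : (1 + r ^ 2) ^ k * ‖iteratedFDeriv ℝ m φ (r, ω)‖ ≤ etaSemi k m φ := by
  obtain ⟨C, hC⟩ := h.2.2.2.1 k m
  have hC0 : 0 ≤ max C 0 := le_max_right _ _
  have h1 (r : ℝ) (ω : EuclideanSpace ℝ (Fin n)) (hω : ‖ω‖ = 1) := (hC r ω hω).trans (le_max_left C 0)
  rw [← iteratedFDerivWithin_punctured m φ r hω]
  unfold etaSemi
  refine le_ciSup_of_le ⟨max C 0, ?_⟩ r (le_ciSup_of_le ⟨max C 0, ?_⟩ ω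
    (le_ciSup_of_le ⟨max C 0, ?_⟩ hω le_rfl))
  · rintro _ ⟨r, rfl⟩
    exact Real.iSup_le (fun ω => Real.iSup_le (fun hω => h1 r ω hω) hC0) hC0
  · rintro _ ⟨ω, rfl⟩
    exact Real.iSup_le (fun hω => h1 r ω hω) hC0
  · rintro _ ⟨hω, rfl⟩
    exact h1 r ω hω

/-- The double sum of the seminorms of `𝒮_H` up to given orders. -/
def etaSum (K M : ℕ) (φ : ℝ × EuclideanSpace ℝ (Fin n) → ℂ) : ℝ :=
  ∑ k ∈ range (K + 1), ∑ m ∈ range (M + 1), etaSemi k m φ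

lemma sum_etaSemi_le {k m K M : ℕ} (hk : k ≤ K) (hm : m ≤ M)
    (φ : ℝ × EuclideanSpace ℝ (Fin n) → ℂ) :
    ∑ j ∈ range (m + 1), etaSemi k j φ ≤ etaSum K M φ := by
  refine (sum_le_sum_of_subset_of_nonneg (range_mono (by omega : m + 1 ≤ M + 1))
    fun j _ _ => etaSemi_nonneg k j φ).trans ?_
  exact single_le_sum (f := fun k => ∑ m ∈ range (M + 1), etaSemi k m φ)
    (fun _ _ => sum_nonneg fun _ _ => etaSemi_nonneg _ _ φ) (mem_range.2 (Nat.lt_succ_of_le hk))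

lemma contDiffOn_norm_punctured {E : Type} [NormedAddCommGroup E] [InnerProductSpace ℝ E] :
    ContDiffOn ℝ (⊤ : ℕ∞) (fun x : E => ‖x‖) {x | x ≠ 0} :=
  fun _ hx => (contDiffAt_norm ℝ hx).contDiffWithinAt

lemma contDiffOn_inv_norm_punctured {E : Type} [NormedAddCommGroup E] [InnerProductSpace ℝ E] :
    ContDiffOn ℝ (⊤ : ℕ∞) (fun x : E => ‖x‖⁻¹) {x | x ≠ 0} :=
  contDiffOn_norm_punctured.inv fun _ hx => norm_ne_zero_iff.2 hx

/-- The extension of a function on `ℝ × S^{n-1}` that is homogeneous of degree `-1` in both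
variables jointly. -/
abbrev density (φ : ℝ × EuclideanSpace ℝ (Fin n) → ℂ) : ℝ × EuclideanSpace ℝ (Fin n) → ℂ :=
  twist (fun x => ‖x‖⁻¹) φ

lemma exists_norm_iteratedFDeriv_density_le (n k m : ℕ) : ∃ C : ℝ, 0 ≤ C ∧
    ∀ φ : ℝ × EuclideanSpace ℝ (Fin n) → ℂ, IsSH φ → ∀ (r : ℝ) (ω : EuclideanSpace ℝ (Fin n)),
      ‖ω‖ = 1 → (1 + r ^ 2) ^ k * ‖iteratedFDeriv ℝ m (density φ) (r, ω)‖ ≤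
        C * ∑ j ∈ range (m + 1), etaSemi (k + m) j φ := by
  obtain ⟨C, hC, h⟩ := exists_norm_iteratedFDeriv_twist_le
    (contDiffOn_inv_norm_punctured (E := EuclideanSpace ℝ (Fin n))) (fun ω hω => by simp [hω]) m
  refine ⟨C * 2 ^ m, by positivity, fun φ hφ r ω hω => ?_⟩
  have h1 : (1 + |r|) ^ m ≤ 2 ^ m * (1 + r ^ 2) ^ m := by
    rw [← mul_pow]
    have : 1 + |r| ≤ 2 * (1 + r ^ 2) := by nlinarith [sq_abs r, abs_nonneg r, sq_nonneg (|r| - 1)]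
    gcongr
  calc (1 + r ^ 2) ^ k * ‖iteratedFDeriv ℝ m (density φ) (r, ω)‖
      ≤ (1 + r ^ 2) ^ k * (C * (2 ^ m * (1 + r ^ 2) ^ m) *
          ∑ j ∈ range (m + 1), ‖iteratedFDeriv ℝ j φ (r, ω)‖) := by
        refine mul_le_mul_of_nonneg_left ((h ℂ φ hφ.contDiffOn r ω hω).trans ?_) (by positivity)
        gcongr
    _ = C * 2 ^ m * ∑ j ∈ range (m + 1),
          (1 + r ^ 2) ^ (k + m) * ‖iteratedFDeriv ℝ j φ (r, ω)‖ := by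
        rw [← mul_sum, pow_add]
        ring
    _ ≤ _ := by
        gcongr with j
        exact hφ.le_etaSemi _ _ _ hω

lemma IsSH.apply_smul (h : IsSH φ) (r : ℝ) {t : ℝ} (ht : 0 < t) (x : EuclideanSpace ℝ (Fin n)) :
    φ (r, t • x) = φ (r, x) := h.1 r t x ht

lemma IsSH.radialClass (h : IsSH φ) : RadialClass 1 (density φ) where
  smooth := contDiffOn_twist contDiffOn_inv_norm_punctured h.contDiffOn
  homog := by
    rintro t ht ⟨r, x⟩ hx
    have hx : ‖x‖ ≠ 0 := norm_ne_zero_iff.2 hx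
    have e : t * r * (t * ‖x‖)⁻¹ = r * ‖x‖⁻¹ := by field_simp
    simp only [density, twist, Prod.smul_mk, norm_smul, Real.norm_eq_abs, abs_of_pos ht, smul_eq_mul,
      e, h.apply_smul _ ht, smul_smul]
    congr 1
    field_simp
  decay k m := by
    obtain ⟨C, -, hC⟩ := exists_norm_iteratedFDeriv_density_le n k m
    exact ⟨_, hC φ h⟩

lemma density_of_norm_eq_one (φ : ℝ × EuclideanSpace ℝ (Fin n) → ℂ) (r : ℝ)
    {ω : EuclideanSpace ℝ (Fin n)} (hω : ‖ω‖ = 1) : density φ (r, ω) = φ (r, ω) := by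
  simp [density, twist, hω]

lemma eval_smul_of_isHomogeneous {P : MvPolynomial (Fin n) ℂ} {k : ℕ} (hP : P.IsHomogeneous k)
    (t : ℝ) (x : Fin n → ℂ) :
    MvPolynomial.eval (fun i => (t : ℂ) * x i) P = t ^ k • MvPolynomial.eval x P := by
  simp only [MvPolynomial.eval_eq', smul_sum]
  refine sum_congr rfl fun d hd => ?_
  have hdk : ∑ i, d i = k := by
    rw [← hP (MvPolynomial.mem_support_iff.1 hd), Finsupp.weight_apply, Finsupp.sum_fintype _ _ (by simp)]
    simp
  simp only [mul_pow, prod_mul_distrib, prod_pow_eq_pow_sum, hdk, real_smul, ofReal_pow]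
  ring

lemma contDiff_eval (P : MvPolynomial (Fin n) ℂ) :
    ContDiff ℝ (⊤ : ℕ∞) fun ξ : EuclideanSpace ℝ (Fin n) =>
      MvPolynomial.eval (fun i => (ξ i : ℂ)) P := by
  have hc (i : Fin n) : ContDiff ℝ (⊤ : ℕ∞) fun ξ : EuclideanSpace ℝ (Fin n) => (ξ i : ℂ) :=
    Complex.ofRealCLM.contDiff.comp (EuclideanSpace.proj (𝕜 := ℝ) i).contDiff
  simp only [MvPolynomial.eval_eq]
  exact ContDiff.sum fun d _ => contDiff_const.mul (contDiff_prod fun i _ => (hc i).pow _)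

lemma IsSH.hasMoments (h : IsSH φ) : ∃ Q, HasMoments (density φ) Q := by
  choose P hP hPφ using h.2.2.2.2
  refine ⟨fun k ξ => MvPolynomial.eval (fun i => (ξ i : ℂ)) (P k), fun k => ?_, fun k t ξ => ?_,
    fun k ξ hξ => ?_⟩
  · exact contDiff_eval (P k)
  · have := eval_smul_of_isHomogeneous (hP k) t fun i => (ξ i : ℂ)
    simp only [PiLp.smul_apply, smul_eq_mul, ofReal_mul]
    exact this
  · have hn : 0 < ‖ξ‖ := norm_pos_iff.2 hξ
    have hω : ‖‖ξ‖⁻¹ • ξ‖ = 1 := by rw [norm_smul, norm_inv, norm_norm, inv_mul_cancel₀ hn.ne']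
    have e : ∀ r : ℝ, (r : ℂ) ^ k • density φ (r, ξ) = (fun r : ℝ => ((‖ξ‖ : ℂ) ^ k * (‖ξ‖ : ℂ)⁻¹) *
        (φ (r, ‖ξ‖⁻¹ • ξ) * (r : ℂ) ^ k)) (r * ‖ξ‖⁻¹) := fun r => by
      have : (‖ξ‖ : ℂ) ≠ 0 := by exact_mod_cast hn.ne'
      simp only [density, twist, h.apply_smul _ (inv_pos.2 hn), smul_eq_mul, real_smul, ofReal_mul,
        ofReal_inv, mul_pow]
      have h1 : (‖ξ‖ : ℂ) ^ k * ((‖ξ‖ : ℂ)⁻¹) ^ k = 1 := by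
        rw [← mul_pow, mul_inv_cancel₀ this, one_pow]
      linear_combination -((r : ℂ) ^ k * ((‖ξ‖ : ℂ)⁻¹ * φ (r * ‖ξ‖⁻¹, ξ))) * h1
    have hs : (‖ξ‖ : ℝ) • (‖ξ‖⁻¹ • ξ) = ξ := smul_inv_smul₀ hn.ne' ξ
    simp only [e]
    rw [Measure.integral_comp_mul_right (fun r : ℝ => ((‖ξ‖ : ℂ) ^ k * (‖ξ‖ : ℂ)⁻¹) *
        (φ (r, ‖ξ‖⁻¹ • ξ) * (r : ℂ) ^ k)), integral_const_mul, hPφ k _ hω, inv_inv,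
      abs_of_pos hn, real_smul]
    conv_rhs => rw [← hs]
    have := eval_smul_of_isHomogeneous (hP k) ‖ξ‖ (fun i => (((‖ξ‖⁻¹ • ξ) i : ℝ) : ℂ))
    have h0 : (‖ξ‖ : ℂ) ≠ 0 := by exact_mod_cast hn.ne'
    rw [show (fun i => (((‖ξ‖ • ‖ξ‖⁻¹ • ξ) i : ℝ) : ℂ)) =
      fun i => (‖ξ‖ : ℂ) * (((‖ξ‖⁻¹ • ξ) i : ℝ) : ℂ) from funext fun i => by simp, this, real_smul, ofReal_pow]
    field_simp

lemma profileInt_density (φ : ℝ × EuclideanSpace ℝ (Fin n) → ℂ) {ω : EuclideanSpace ℝ (Fin n)}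
    (hφ : IsHomog0 φ) (hω : ‖ω‖ = 1) {s : ℝ} (hs : 0 < s) :
    profileInt (fun r => waveKernel (-1) r) (density φ) (s • ω) =
      ∫ r : ℝ, waveKernel (-s) r * φ (r, ω) := by
  have e : ∀ r : ℝ, waveKernel (-1) r • density φ (r, s • ω) =
      (fun r : ℝ => (s : ℂ)⁻¹ * (waveKernel (-s) r * φ (r, ω))) (r * s⁻¹) := fun r => by
    have h0 : (s : ℂ) ≠ 0 := by exact_mod_cast hs.ne'
    simp only [density, twist, norm_smul, hω, mul_one, Real.norm_eq_abs, abs_of_pos hs,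
      hφ _ _ _ hs, waveKernel, smul_eq_mul, real_smul, ofReal_inv, ofReal_mul, ofReal_neg]
    rw [show (2 * π * I * (-s * (r * (s : ℂ)⁻¹)) : ℂ) = 2 * π * I * (-(1 : ℝ) * r) by
      push_cast; field_simp]
    push_cast
    ring
  have h0 : (s : ℂ) ≠ 0 := by exact_mod_cast hs.ne'
  simp only [profileInt, e]
  rw [Measure.integral_comp_mul_right (fun r : ℝ => (s : ℂ)⁻¹ * (waveKernel (-s) r * φ (r, ω))),
    integral_const_mul, inv_inv, abs_of_pos hs, real_smul, mul_inv_cancel_left₀ h0]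

lemma exists_seminorm_le_etaSum (hn : 1 ≤ n) (K M : ℕ) : ∃ C : ℝ, 0 ≤ C ∧ ∃ k m : ℕ,
    ∀ φ : ℝ × EuclideanSpace ℝ (Fin n) → ℂ, IsSH φ → ∀ F : 𝓢(EuclideanSpace ℝ (Fin n), ℂ),
      (∀ ξ, ξ ≠ 0 → F ξ = profileInt (fun r => waveKernel (-1) r) (density φ) ξ) →
      SchwartzMap.seminorm ℝ K M F ≤ C * etaSum k m φ := by
  have : Nonempty (Fin n) := ⟨⟨0, hn⟩⟩
  obtain ⟨C, hC0, hC⟩ := exists_pow_mul_norm_iteratedFDeriv_fourier_le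
    (E := EuclideanSpace ℝ (Fin n)) K M
  obtain ⟨C₁, hC₁0, hC₁⟩ := exists_norm_iteratedFDeriv_density_le n (M + 1) M
  obtain ⟨C₂, hC₂0, hC₂⟩ := exists_norm_iteratedFDeriv_density_le n 1 (M + K)
  simp only [pow_one] at hC₂
  refine ⟨C * (C₁ + C₂), by positivity, M + 1 + M + (1 + (M + K)), M + K, fun φ hφ F hF => ?_⟩
  obtain ⟨Q, hQ⟩ := hφ.hasMoments
  have hS := sum_etaSemi_le (k := M + 1 + M) (m := M) (K := M + 1 + M + (1 + (M + K)))
    (M := M + K) (by omega) (by omega) φ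
  have hS' := sum_etaSemi_le (k := 1 + (M + K)) (m := M + K) (K := M + 1 + M + (1 + (M + K)))
    (M := M + K) (by omega) (by omega) φ
  set S := etaSum (M + 1 + M + (1 + (M + K))) (M + K) φ with hSdef
  have hS0 : 0 ≤ S := sum_nonneg fun _ _ => sum_nonneg fun _ _ => etaSemi_nonneg _ _ φ
  have hb := hC ℂ (density φ) Q ((C₁ + C₂) * S) hφ.radialClass hQ
    (fun r ω hω => (hC₁ φ hφ r ω hω).trans
      (mul_le_mul (by linarith) hS (sum_nonneg fun _ _ => etaSemi_nonneg _ _ φ) (by positivity)))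
    (fun r ω hω => (hC₂ φ hφ r ω hω).trans
      (mul_le_mul (by linarith) hS' (sum_nonneg fun _ _ => etaSemi_nonneg _ _ φ) (by positivity)))
  refine SchwartzMap.seminorm_le_bound ℝ K M F (by positivity) fun ξ => ?_
  rw [mul_assoc]
  exact forall_pow_mul_norm_iteratedFDeriv_le (F.smooth _) hF hb ξ

end Backward

section Slicing

variable {d : ℕ}

/-- Points of the hyperplanes orthogonal to `e (e₀)`, parametrized by signed distance from the
origin and orthonormal coordinates. -/
def hyperSlice (e : EuclideanSpace ℝ (Fin (d + 1)) ≃ₗᵢ[ℝ] EuclideanSpace ℝ (Fin (d + 1)))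
    (q : ℝ × EuclideanSpace ℝ (Fin d)) : EuclideanSpace ℝ (Fin (d + 1)) :=
  e (WithLp.toLp 2 (Fin.cons q.1 q.2))

variable (e : EuclideanSpace ℝ (Fin (d + 1)) ≃ₗᵢ[ℝ] EuclideanSpace ℝ (Fin (d + 1)))

/-- `hyperSlice` as a measurable equivalence. -/
def sliceEquiv : ℝ × EuclideanSpace ℝ (Fin d) ≃ᵐ EuclideanSpace ℝ (Fin (d + 1)) :=
  (((MeasurableEquiv.refl ℝ).prodCongr (MeasurableEquiv.toLp 2 (Fin d → ℝ)).symm).trans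
    (MeasurableEquiv.piFinSuccAbove (fun _ : Fin (d + 1) => ℝ) 0).symm).trans
    ((MeasurableEquiv.toLp 2 (Fin (d + 1) → ℝ)).trans e.toHomeomorph.toMeasurableEquiv)

lemma coe_sliceEquiv : ⇑(sliceEquiv e) = hyperSlice e := by
  ext1 q
  simp [sliceEquiv, hyperSlice, MeasurableEquiv.prodCongr, MeasurableEquiv.piFinSuccAbove, Fin.insertNthEquiv, Fin.insertNth_zero']

lemma measurePreserving_hyperSlice : MeasurePreserving (hyperSlice e) (volume.prod volume) volume := by
  rw [← coe_sliceEquiv]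
  have h1 := (MeasurePreserving.id (volume : Measure ℝ)).prod (PiLp.volume_preserving_ofLp (Fin d))
  have h2 := (volume_preserving_piFinSuccAbove (fun _ : Fin (d + 1) => ℝ) 0).symm
  have h3 := PiLp.volume_preserving_toLp (Fin (d + 1))
  exact e.measurePreserving.comp (h3.comp (h2.comp h1))

lemma norm_hyperSlice_sq (q : ℝ × EuclideanSpace ℝ (Fin d)) :
    ‖hyperSlice e q‖ ^ 2 = q.1 ^ 2 + ‖q.2‖ ^ 2 := by
  rw [hyperSlice, e.norm_map, EuclideanSpace.norm_sq_eq, Fin.sum_univ_succ, EuclideanSpace.norm_sq_eq]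
  simp

lemma inner_hyperSlice (q : ℝ × EuclideanSpace ℝ (Fin d)) :
    inner ℝ (hyperSlice e q) (e (EuclideanSpace.single 0 1)) = q.1 := by
  rw [hyperSlice, e.inner_map_map, EuclideanSpace.inner_single_right]
  simp

lemma hyperSlice_sub (p : ℝ) (y z : EuclideanSpace ℝ (Fin d)) :
    hyperSlice e (p, y) - hyperSlice e (p, z) = hyperSlice e (0, y - z) := by
  simp only [hyperSlice, ← map_sub]
  congr 1
  ext i
  refine Fin.cases ?_ (fun i => ?_) i <;> simp

lemma isometry_hyperSlice (p : ℝ) : Isometry fun y => hyperSlice e (p, y) := by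
  refine Isometry.of_dist_eq fun y z => ?_
  rw [dist_eq_norm, dist_eq_norm, hyperSlice_sub, ← sq_eq_sq₀ (norm_nonneg _) (norm_nonneg _),
    norm_hyperSlice_sq]
  simp

lemma continuous_hyperSlice : Continuous (hyperSlice e) := by
  refine e.continuous.comp ((PiLp.continuous_toLp 2 _).comp (continuous_pi fun i => ?_))
  refine Fin.cases ?_ (fun i => ?_) i
  · simpa using continuous_fst
  · simp only [Fin.cons_succ]
    fun_prop

lemma surjective_hyperSlice : Function.Surjective (hyperSlice e) := by
  rw [← coe_sliceEquiv]
  exact (sliceEquiv e).surjective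

lemma range_hyperSlice (p : ℝ) :
    Set.range (fun y => hyperSlice e (p, y)) = {x | inner ℝ x (e (EuclideanSpace.single 0 1)) = p} := by
  ext x
  obtain ⟨⟨r, y⟩, rfl⟩ := surjective_hyperSlice e x
  constructor
  · rintro ⟨z, hz⟩
    simp only at hz
    rw [← hz]
    exact inner_hyperSlice e (p, z)
  · intro h
    rw [Set.mem_ofPred_eq, inner_hyperSlice] at h
    exact ⟨y, by rw [← h]⟩

lemma exists_isometryEquiv_single {ω : EuclideanSpace ℝ (Fin (d + 1))} (hω : ‖ω‖ = 1) :
    ∃ e : EuclideanSpace ℝ (Fin (d + 1)) ≃ₗᵢ[ℝ] EuclideanSpace ℝ (Fin (d + 1)),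
      e (EuclideanSpace.single 0 1) = ω := by
  obtain ⟨b, hb⟩ := Orthonormal.exists_orthonormalBasis_extension_of_card_eq (𝕜 := ℝ)
    (E := EuclideanSpace ℝ (Fin (d + 1))) (ι := Fin (d + 1)) (by simp) (v := fun _ => ω) (s := {0})
    ⟨fun _ => hω, fun i j hij => (hij (Subsingleton.elim _ _)).elim⟩
  refine ⟨b.repr.symm, ?_⟩
  rw [b.repr_symm_single]
  exact hb 0 rfl

/-- The ratio of `d`-dimensional Hausdorff measure to Lebesgue measure. -/
def radonConst (d : ℕ) : ℝ :=
  Measure.addHaarScalarFactor (μH[d] : Measure (EuclideanSpace ℝ (Fin d))) volume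

lemma radonConst_pos (d : ℕ) : 0 < radonConst d :=
  NNReal.coe_pos.2 (Measure.addHaarScalarFactor_pos_of_isAddHaarMeasure _ _)

lemma radonConst_ne_zero (d : ℕ) : (radonConst d : ℂ) ≠ 0 := by
  exact_mod_cast (radonConst_pos d).ne'

lemma radonH_eq_mul_integral_hyperSlice (f : EuclideanSpace ℝ (Fin (d + 1)) → ℂ) (p : ℝ) :
    RadonH f (p, e (EuclideanSpace.single 0 1)) = radonConst d * ∫ y, f (hyperSlice e (p, y)) := by
  have hs : {x : EuclideanSpace ℝ (Fin (d + 1)) | ∑ i, x i * (e (EuclideanSpace.single 0 1)) i =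
      p * ‖e (EuclideanSpace.single 0 1)‖} = Set.range fun y => hyperSlice e (p, y) := by
    rw [range_hyperSlice]
    ext x
    simp [PiLp.inner_apply, mul_comm]
  have hi := isometry_hyperSlice e p
  unfold RadonH
  simp only
  rw [hs, show (((d + 1 : ℕ) : ℝ) - 1) = d by push_cast; ring,
    ← hi.map_hausdorffMeasure (Or.inl d.cast_nonneg),
    hi.isClosedEmbedding.measurableEmbedding.integral_map]
  have h := congrArg (fun μ : Measure (EuclideanSpace ℝ (Fin d)) => ∫ y, f (hyperSlice e (p, y)) ∂μ)
    (Measure.isAddLeftInvariant_eq_smul (μH[d] : Measure (EuclideanSpace ℝ (Fin d))) volume)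
  rw [integral_smul_nnreal_measure] at h
  exact h.trans (NNReal.smul_def _ _)

variable {ω : EuclideanSpace ℝ (Fin (d + 1))}

lemma integral_mul_radonH (hω : ‖ω‖ = 1) {f : EuclideanSpace ℝ (Fin (d + 1)) → ℂ} {h : ℝ → ℂ}
    (hf : Integrable fun x => h (inner ℝ x ω) * f x) :
    ∫ p : ℝ, h p * RadonH f (p, ω) = radonConst d * ∫ x, h (inner ℝ x ω) * f x := by
  obtain ⟨e, rfl⟩ := exists_isometryEquiv_single hω
  have hm := measurePreserving_hyperSlice e
  have he : MeasurableEmbedding (hyperSlice e) := by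
    rw [← coe_sliceEquiv]
    exact (sliceEquiv e).measurableEmbedding
  have hi := (hm.integrable_comp_emb he).2 hf
  simp only [Function.comp_def] at hi
  rw [← hm.integral_comp he, integral_prod _ hi, ← integral_const_mul]
  congr 1
  ext1 p
  simp only [inner_hyperSlice, integral_const_mul, radonH_eq_mul_integral_hyperSlice]
  ring

lemma integrable_radonH (hω : ‖ω‖ = 1) {f : EuclideanSpace ℝ (Fin (d + 1)) → ℂ}
    (hf : Integrable f) : Integrable fun p : ℝ => RadonH f (p, ω) := by
  obtain ⟨e, rfl⟩ := exists_isometryEquiv_single hω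
  have hm := measurePreserving_hyperSlice e
  have he : MeasurableEmbedding (hyperSlice e) := by
    rw [← coe_sliceEquiv]
    exact (sliceEquiv e).measurableEmbedding
  simp only [radonH_eq_mul_integral_hyperSlice]
  exact ((hm.integrable_comp_emb he).2 hf).integral_prod_left.const_mul _

lemma SchwartzMap.exists_norm_le_one_add_norm_rpow {E : Type} [NormedAddCommGroup E]
    [NormedSpace ℝ E] (f : 𝓢(E, ℂ)) (k : ℕ) :
    ∃ C : ℝ, 0 ≤ C ∧ ∀ x, ‖f x‖ ≤ C * (1 + ‖x‖) ^ (-(k : ℝ)) := by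
  refine ⟨2 ^ k * ((Finset.Iic (k, 0)).sup fun m => SchwartzMap.seminorm ℝ m.1 m.2) f,
    by positivity, fun x => ?_⟩
  have h := SchwartzMap.one_add_le_sup_seminorm_apply (𝕜 := ℝ) (m := (k, 0)) le_rfl le_rfl f x
  rw [norm_iteratedFDeriv_zero] at h
  have hx : 0 < (1 + ‖x‖) ^ k := by positivity
  rw [Real.rpow_neg (by positivity), Real.rpow_natCast, ← div_eq_mul_inv, le_div_iff₀ hx]
  linarith

lemma continuous_radonH (hω : ‖ω‖ = 1) (f : 𝓢(EuclideanSpace ℝ (Fin (d + 1)), ℂ)) :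
    Continuous fun p : ℝ => RadonH f (p, ω) := by
  obtain ⟨e, rfl⟩ := exists_isometryEquiv_single hω
  simp only [radonH_eq_mul_integral_hyperSlice]
  obtain ⟨C, hC, hf⟩ := f.exists_norm_le_one_add_norm_rpow (d + 1)
  refine continuous_const.mul (continuous_of_dominated (bound := fun y =>
    C * (1 + ‖y‖) ^ (-((d + 1 : ℕ) : ℝ))) (fun p => ?_) (fun p => ?_) ?_ ?_)
  · exact (f.continuous.comp (isometry_hyperSlice e p).continuous).aestronglyMeasurable
  · refine Filter.Eventually.of_forall fun y => (hf _).trans ?_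
    have : ‖y‖ ≤ ‖hyperSlice e (p, y)‖ := by
      have := norm_hyperSlice_sq e (p, y)
      refine abs_le_of_sq_le_sq' ?_ (norm_nonneg _) |>.2
      nlinarith [sq_nonneg p]
    refine mul_le_mul_of_nonneg_left ?_ hC
    exact Real.rpow_le_rpow_of_nonpos (by positivity) (by linarith) (neg_nonpos.2 (Nat.cast_nonneg _))
  · exact (integrable_one_add_norm (by simp)).const_mul C
  · refine Filter.Eventually.of_forall fun y => f.continuous.comp ((continuous_hyperSlice e).comp ?_)
    fun_prop

end Slicing

section Inversion

lemma waveKernel_neg_eq (s p : ℝ) : waveKernel (-s) p = cexp (↑(-2 * π * p * s) * I) := by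
  rw [waveKernel]
  congr 1
  push_cast
  ring

lemma fourier_inversion_real {g : ℝ → ℂ} (hc : Continuous g) (hg : Integrable g)
    (hs : Integrable fun s : ℝ => ∫ p : ℝ, waveKernel (-s) p * g p) (p : ℝ) :
    g p = ∫ s : ℝ, waveKernel s p * ∫ p : ℝ, waveKernel (-s) p * g p := by
  have h1 : 𝓕 g = fun s : ℝ => ∫ p : ℝ, waveKernel (-s) p * g p := by
    ext1 s
    simp only [Real.fourier_real_eq_integral_exp_smul, waveKernel_neg_eq, smul_eq_mul]
  have h2 := congrFun (hc.fourierInv_fourier_eq hg (h1 ▸ hs)) p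
  rw [h1, Real.fourierInv_eq'] at h2
  rw [← h2]
  congr 1
  ext1 s
  rw [smul_eq_mul, waveKernel]
  congr 2
  simp
  ring

variable {d : ℕ} {ω : EuclideanSpace ℝ (Fin (d + 1))}

lemma integral_waveKernel_mul_radonH (hω : ‖ω‖ = 1)
    (f : 𝓢(EuclideanSpace ℝ (Fin (d + 1)), ℂ)) (s : ℝ) :
    ∫ p : ℝ, waveKernel (-s) p * RadonH f (p, ω) = radonConst d * 𝓕 f (s • ω) := by
  rw [integral_mul_radonH hω, SchwartzMap.fourier_coe, Real.fourier_eq']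
  · congr 2
    ext1 x
    rw [waveKernel_neg_eq, inner_smul_right, smul_eq_mul]
    congr 4
    ring
  · refine f.integrable.bdd_mul (c := 1) ?_ (Filter.Eventually.of_forall fun x => (norm_waveKernel _ _).le)
    exact ((continuous_waveKernel_right _).comp (by fun_prop)).aestronglyMeasurable

lemma radonH_eq_radialWave (hω : ‖ω‖ = 1) (f : 𝓢(EuclideanSpace ℝ (Fin (d + 1)), ℂ)) (p : ℝ) :
    RadonH f (p, ω) = radonConst d *
      radialWave 0 (𝓕 f : 𝓢(EuclideanSpace ℝ (Fin (d + 1)), ℂ)) (p, ω) := by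
  have h0 : ω ≠ 0 := norm_ne_zero_iff.1 (by simp [hω])
  have hi := integrable_radialWave 0 (𝓕 f) (q := (0, ω)) h0
  have h := fourier_inversion_real (continuous_radonH hω f) (integrable_radonH hω f.integrable) (by
    simp only [integral_waveKernel_mul_radonH hω]
    refine Integrable.const_mul ?_ _
    simpa [waveKernel] using hi) p
  rw [h, radialWave, ← integral_const_mul]
  congr 1
  ext1 s
  rw [integral_waveKernel_mul_radonH hω, pow_zero, one_mul, smul_eq_mul]
  ring

end Inversion

section Bounds

lemma exists_sum_le_mul {ι α : Type} (s : Finset ι) {a : ι → α → ℝ} {S : ℕ → ℕ → α → ℝ}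
    (hS : ∀ {K K' M M' : ℕ}, K ≤ K' → M ≤ M' → ∀ x, S K M x ≤ S K' M' x)
    (h : ∀ i, ∃ C : ℝ, 0 ≤ C ∧ ∃ K M : ℕ, ∀ x, a i x ≤ C * S K M x) :
    ∃ C : ℝ, 0 ≤ C ∧ ∃ K M : ℕ, ∀ x, ∑ i ∈ s, a i x ≤ C * S K M x := by
  classical
  induction s using Finset.induction_on with
  | empty => exact ⟨0, le_rfl, 0, 0, fun x => by simp⟩
  | insert i s hi ih =>
    obtain ⟨C₁, hC₁, K₁, M₁, h₁⟩ := h i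
    obtain ⟨C₂, hC₂, K₂, M₂, h₂⟩ := ih
    refine ⟨C₁ + C₂, by positivity, max K₁ K₂, max M₁ M₂, fun x => ?_⟩
    rw [sum_insert hi, add_mul]
    exact add_le_add
      ((h₁ x).trans (mul_le_mul_of_nonneg_left (hS (le_max_left _ _) (le_max_left _ _) x) hC₁))
      ((h₂ x).trans (mul_le_mul_of_nonneg_left (hS (le_max_right _ _) (le_max_right _ _) x) hC₂))

variable {E : Type} [NormedAddCommGroup E] [NormedSpace ℝ E]

lemma exists_seminorm_clm_le (T : 𝓢(E, ℂ) →L[ℝ] 𝓢(E, ℂ)) (k m : ℕ) :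
    ∃ C : ℝ, 0 ≤ C ∧ ∃ K M : ℕ, ∀ f : 𝓢(E, ℂ),
      SchwartzMap.seminorm ℝ k m (T f) ≤ C * schwartzSum K M f := by
  have hw := schwartz_withSeminorms ℝ E ℂ
  have hc : Continuous ⇑((SchwartzMap.seminorm ℝ k m).comp (T : 𝓢(E, ℂ) →ₗ[ℝ] 𝓢(E, ℂ))) :=
    (hw.continuous_seminorm (k, m)).comp T.continuous
  obtain ⟨s, C, -, h⟩ := Seminorm.bound_of_continuous hw _ hc
  refine ⟨C, C.2, s.sup Prod.fst, s.sup Prod.snd, fun f => (h f).trans ?_⟩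
  refine mul_le_mul_of_nonneg_left ?_ C.2
  exact Seminorm.finset_sup_apply_le (schwartzSum_nonneg _ _ f) fun i hi =>
    seminorm_le_schwartzSum (le_sup (f := Prod.fst) hi) (le_sup (f := Prod.snd) hi) f

lemma exists_schwartzSum_clm_le (T : 𝓢(E, ℂ) →L[ℝ] 𝓢(E, ℂ)) (k m : ℕ) :
    ∃ C : ℝ, 0 ≤ C ∧ ∃ K M : ℕ, ∀ f : 𝓢(E, ℂ),
      schwartzSum k m (T f) ≤ C * schwartzSum K M f :=
  exists_sum_le_mul (range (k + 1)) (fun hK hM => schwartzSum_mono hK hM)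
    fun k => exists_sum_le_mul (range (m + 1))
      (fun hK hM => schwartzSum_mono hK hM) fun m => exists_seminorm_clm_le T k m

lemma one_add_sq_pow_mul_le (k m : ℕ) (p : ℝ) :
    (1 + p ^ 2) ^ k * (1 + |p|) ^ m ≤
      2 ^ (2 * k + m) * (|p| ^ 0 + |p| ^ (2 * k + m)) := by
  have h1 : 1 + p ^ 2 ≤ (1 + |p|) ^ 2 := by nlinarith [sq_abs p, abs_nonneg p]
  calc (1 + p ^ 2) ^ k * (1 + |p|) ^ m ≤ ((1 + |p|) ^ 2) ^ k * (1 + |p|) ^ m := by gcongr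
    _ = (1 + |p|) ^ (2 * k + m) := by rw [← pow_mul, ← pow_add]
    _ ≤ 2 ^ (2 * k + m - 1) * (1 ^ (2 * k + m) + |p| ^ (2 * k + m)) :=
      add_pow_le zero_le_one (abs_nonneg p) _
    _ ≤ _ := by
      rw [one_pow, pow_zero]
      gcongr
      · exact one_le_two
      · omega

lemma exists_norm_iteratedFDeriv_twist_radialWave_le (d k m : ℕ) :
    ∃ C : ℝ, 0 ≤ C ∧ ∃ K M : ℕ, ∀ (F : 𝓢(EuclideanSpace ℝ (Fin d), ℂ)) (p : ℝ)
      (ω : EuclideanSpace ℝ (Fin d)), ‖ω‖ = 1 →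
      (1 + p ^ 2) ^ k * ‖iteratedFDeriv ℝ m (twist (fun x => ‖x‖) (radialWave 0 F)) (p, ω)‖ ≤
        C * schwartzSum K M F := by
  obtain ⟨C, hC, h⟩ := exists_norm_iteratedFDeriv_twist_le
    (contDiffOn_norm_punctured (E := EuclideanSpace ℝ (Fin d))) (fun ω hω => hω) m
  obtain ⟨C', hC', K, M, h'⟩ := exists_sum_le_mul
    (α := 𝓢(EuclideanSpace ℝ (Fin d), ℂ) × ℝ × Metric.sphere (0 : EuclideanSpace ℝ (Fin d)) 1)
    (a := fun j x => (1 + x.2.1 ^ 2) ^ k * (1 + |x.2.1|) ^ m *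
      ‖iteratedFDeriv ℝ j (radialWave 0 x.1) (x.2.1, x.2.2.1)‖)
    (S := fun K M x => schwartzSum K M x.1) (range (m + 1))
    (fun hK hM x => schwartzSum_mono hK hM x.1) fun j => by
      obtain ⟨C₁, hC₁, K₁, M₁, h₁⟩ := exists_pow_mul_norm_iteratedFDeriv_radialWave_le
        (E := EuclideanSpace ℝ (Fin d)) 0 j 0
      obtain ⟨C₂, hC₂, K₂, M₂, h₂⟩ := exists_pow_mul_norm_iteratedFDeriv_radialWave_le
        (E := EuclideanSpace ℝ (Fin d)) (2 * k + m) j 0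
      refine ⟨2 ^ (2 * k + m) * (C₁ + C₂), by positivity, max K₁ K₂, max M₁ M₂, ?_⟩
      rintro ⟨F, p, ω, hω⟩
      have hω : ‖ω‖ = 1 := by simpa using hω
      have e₁ := (h₁ ℂ F p ω hω).trans (mul_le_mul_of_nonneg_left
        (schwartzSum_mono (le_max_left K₁ K₂) (le_max_left M₁ M₂) F) hC₁)
      have e₂ := (h₂ ℂ F p ω hω).trans (mul_le_mul_of_nonneg_left
        (schwartzSum_mono (le_max_right K₁ K₂) (le_max_right M₁ M₂) F) hC₂)
      refine (mul_le_mul_of_nonneg_right (one_add_sq_pow_mul_le k m p) (norm_nonneg _)).trans ?_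
      rw [mul_assoc, mul_assoc, add_mul, add_mul]
      gcongr
  refine ⟨C * C', by positivity, K, M, fun F p ω hω => ?_⟩
  have h1 := h ℂ _ (contDiffOn_radialWave 0 F) p ω hω
  have h2 := h' (F, p, ⟨ω, by simpa using hω⟩)
  simp only [← mul_sum] at h2
  calc _ ≤ (1 + p ^ 2) ^ k * (C * (1 + |p|) ^ m *
        ∑ j ∈ range (m + 1), ‖iteratedFDeriv ℝ j (radialWave 0 F) (p, ω)‖) := by gcongr
    _ = C * ((1 + p ^ 2) ^ k * (1 + |p|) ^ m *
        ∑ j ∈ range (m + 1), ‖iteratedFDeriv ℝ j (radialWave 0 F) (p, ω)‖) := by ring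
    _ ≤ C * (C' * schwartzSum K M F) := by gcongr
    _ = _ := by ring

end Bounds

section Image

lemma isHomog0_radonH (f : EuclideanSpace ℝ (Fin n) → ℂ) : IsHomog0 (RadonH f) := by
  intro r t x ht
  have : {y : EuclideanSpace ℝ (Fin n) | ∑ i, y i * (t • x) i = r * ‖t • x‖} =
      {y | ∑ i, y i * x i = r * ‖x‖} := by
    ext y
    have e : ∑ i, y i * (t • x) i = t * ∑ i, y i * x i := by
      rw [mul_sum]
      exact sum_congr rfl fun i _ => by simp; ring
    rw [Set.mem_ofPred_eq, Set.mem_ofPred_eq, e, norm_smul, Real.norm_of_nonneg ht.le, mul_left_comm,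
      mul_right_inj' ht.ne']
  simp only [RadonH, this]

lemma radonH_neg (f : EuclideanSpace ℝ (Fin n) → ℂ) (r : ℝ) (x : EuclideanSpace ℝ (Fin n)) :
    RadonH f (-r, -x) = RadonH f (r, x) := by
  simp only [RadonH, PiLp.neg_apply, mul_neg, sum_neg_distrib, norm_neg, neg_mul, neg_inj]

variable {d : ℕ} (f : 𝓢(EuclideanSpace ℝ (Fin (d + 1)), ℂ))

lemma radonH_eq_twist {q : ℝ × EuclideanSpace ℝ (Fin (d + 1))} (hq : q.2 ≠ 0) :
    RadonH f q = (radonConst d : ℂ) • twist (fun x => ‖x‖)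
      (radialWave 0 (𝓕 f : 𝓢(EuclideanSpace ℝ (Fin (d + 1)), ℂ))) q := by
  obtain ⟨p, ξ⟩ := q
  have hn : 0 < ‖ξ‖ := norm_pos_iff.2 hq
  have hω : ‖‖ξ‖⁻¹ • ξ‖ = 1 := by rw [norm_smul, norm_inv, norm_norm, inv_mul_cancel₀ hn.ne']
  rw [← isHomog0_radonH f p ‖ξ‖⁻¹ ξ (inv_pos.2 hn), radonH_eq_radialWave hω f p, smul_eq_mul]
  congr 1
  simp only [twist, radialWave]
  set F := (𝓕 f : 𝓢(EuclideanSpace ℝ (Fin (d + 1)), ℂ))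
  have e : ∀ s : ℝ, ((s : ℂ) ^ 0 * waveKernel s p) • F (s • ‖ξ‖⁻¹ • ξ) =
      (fun s : ℝ => ((s : ℂ) ^ 0 * waveKernel s (p * ‖ξ‖)) • F (s • ξ)) (s * ‖ξ‖⁻¹) := fun s => by
    have h0 : (‖ξ‖ : ℂ) ≠ 0 := by exact_mod_cast hn.ne'
    simp only [pow_zero, one_mul, waveKernel, smul_smul]
    congr 3
    push_cast
    field_simp
  simp only [e]
  rw [Measure.integral_comp_mul_right (fun s : ℝ =>
    ((s : ℂ) ^ 0 * waveKernel s (p * ‖ξ‖)) • F (s • ξ)), inv_inv, abs_of_pos hn]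

lemma contDiffOn_radonH : ContDiffOn ℝ (⊤ : ℕ∞) (RadonH f) (punctured _) :=
  ((contDiffOn_twist contDiffOn_norm_punctured (contDiffOn_radialWave 0 _)).const_smul
    (radonConst d : ℂ)).congr fun _ hq => radonH_eq_twist f (mem_punctured.1 hq)

lemma norm_iteratedFDeriv_radonH (m : ℕ) (p : ℝ) {ω : EuclideanSpace ℝ (Fin (d + 1))}
    (hω : ‖ω‖ = 1) : ‖iteratedFDeriv ℝ m (RadonH f) (p, ω)‖ =
      radonConst d * ‖iteratedFDeriv ℝ m (twist (fun x => ‖x‖)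
        (radialWave 0 (𝓕 f : 𝓢(EuclideanSpace ℝ (Fin (d + 1)), ℂ)))) (p, ω)‖ := by
  have hmem : (p, ω) ∈ punctured (EuclideanSpace ℝ (Fin (d + 1))) :=
    mem_punctured_of_norm_eq_one hω
  have hnh := isOpen_punctured.mem_nhds hmem
  have e : RadonH f =ᶠ[𝓝 (p, ω)] (radonConst d : ℂ) • twist (fun x => ‖x‖)
      (radialWave 0 (𝓕 f : 𝓢(EuclideanSpace ℝ (Fin (d + 1)), ℂ))) :=
    Filter.eventually_of_mem hnh fun q hq => radonH_eq_twist f (mem_punctured.1 hq)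
  rw [(e.iteratedFDeriv ℝ m).eq_of_nhds, iteratedFDeriv_const_smul_apply, norm_smul, norm_real,
    Real.norm_of_nonneg (radonConst_pos d).le]
  exact ((contDiffOn_twist contDiffOn_norm_punctured (contDiffOn_radialWave 0 _)).contDiffAt
    hnh).of_le (natCast_le_infty m)

lemma exists_norm_iteratedFDeriv_radonH_le (d k m : ℕ) :
    ∃ C : ℝ, 0 ≤ C ∧ ∃ K M : ℕ, ∀ (f : 𝓢(EuclideanSpace ℝ (Fin (d + 1)), ℂ)) (p : ℝ)
      (ω : EuclideanSpace ℝ (Fin (d + 1))), ‖ω‖ = 1 →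
      (1 + p ^ 2) ^ k * ‖iteratedFDeriv ℝ m (RadonH f) (p, ω)‖ ≤ C * schwartzSum K M f := by
  obtain ⟨C₁, hC₁, K₁, M₁, h₁⟩ := exists_norm_iteratedFDeriv_twist_radialWave_le (d + 1) k m
  obtain ⟨C₂, hC₂, K, M, h₂⟩ := exists_schwartzSum_clm_le
    (FourierTransform.fourierCLM ℝ 𝓢(EuclideanSpace ℝ (Fin (d + 1)), ℂ)) K₁ M₁
  have hc := (radonConst_pos d).le
  refine ⟨radonConst d * C₁ * C₂, by positivity, K, M, fun f p ω hω => ?_⟩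
  rw [norm_iteratedFDeriv_radonH f m p hω, mul_left_comm, mul_assoc, mul_assoc]
  have h2 := h₂ f
  refine mul_le_mul_of_nonneg_left ?_ hc
  exact (h₁ _ p ω hω).trans (mul_le_mul_of_nonneg_left h2 hC₁)

lemma exists_moment_polynomial (k : ℕ) : ∃ P : MvPolynomial (Fin (d + 1)) ℂ, P.IsHomogeneous k ∧
    ∀ ω : EuclideanSpace ℝ (Fin (d + 1)), ‖ω‖ = 1 →
      (∫ r : ℝ, RadonH f (r, ω) * (r : ℂ) ^ k) = MvPolynomial.eval (fun i => (ω i : ℂ)) P := by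
  have hint (σ : Fin k → Fin (d + 1)) : Integrable fun x => (∏ j, (x (σ j) : ℂ)) * f x := by
    refine (f.integrable_pow_mul volume k).mono'
      (Continuous.aestronglyMeasurable (by fun_prop)) (Filter.Eventually.of_forall fun x => ?_)
    rw [norm_mul, norm_prod]
    gcongr
    calc ∏ j, ‖(x (σ j) : ℂ)‖ ≤ ∏ _j : Fin k, ‖x‖ := by
          gcongr with j
          rw [norm_real]
          exact PiLp.norm_apply_le x (σ j)
      _ = ‖x‖ ^ k := by simp
  have hexp (x ω : EuclideanSpace ℝ (Fin (d + 1))) : ((inner ℝ x ω : ℝ) : ℂ) ^ k * f x =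
      ∑ σ : Fin k → Fin (d + 1), (∏ j, (ω (σ j) : ℂ)) * ((∏ j, (x (σ j) : ℂ)) * f x) := by
    rw [PiLp.inner_apply, ofReal_sum, Fintype.sum_pow, sum_mul]
    refine sum_congr rfl fun σ _ => ?_
    simp only [← mul_assoc, ← prod_mul_distrib]
    simp
  refine ⟨∑ σ : Fin k → Fin (d + 1), MvPolynomial.C (radonConst d * ∫ x, (∏ j, (x (σ j) : ℂ)) * f x) *
    ∏ j, MvPolynomial.X (σ j), ?_, fun ω hω => ?_⟩
  · refine MvPolynomial.IsHomogeneous.sum _ _ _ fun σ _ => ?_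
    have := (MvPolynomial.isHomogeneous_C (Fin (d + 1)) (radonConst d * ∫ x,
      (∏ j, (x (σ j) : ℂ)) * f x)).mul (MvPolynomial.IsHomogeneous.prod univ
        (fun j => MvPolynomial.X (σ j)) (fun _ => 1) fun j _ => MvPolynomial.isHomogeneous_X ℂ (σ j))
    simpa using this
  · have hi : Integrable fun x => ((inner ℝ x ω : ℝ) : ℂ) ^ k * f x := by
      simp only [hexp]
      exact integrable_finsetSum _ fun σ _ => (hint σ).const_mul _
    simp only [mul_comm (RadonH f _)]
    rw [integral_mul_radonH hω (h := fun r => (r : ℂ) ^ k) hi]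
    simp only [hexp]
    rw [integral_finsetSum _ fun σ _ => (hint σ).const_mul _, mul_sum]
    simp only [integral_const_mul, map_sum, map_mul, MvPolynomial.eval_C, map_prod,
      MvPolynomial.eval_X]
    exact sum_congr rfl fun σ _ => by ring

lemma isSH_radonH : IsSH (RadonH f) := by
  refine ⟨isHomog0_radonH f, radonH_neg f, contDiffOn_radonH f, fun k m => ?_,
    exists_moment_polynomial f⟩
  obtain ⟨C, -, K, M, h⟩ := exists_norm_iteratedFDeriv_radonH_le d k m
  refine ⟨C * schwartzSum K M f, fun r ω hω => ?_⟩
  rw [iteratedFDerivWithin_punctured m _ r hω]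
  exact h f r ω hω

end Image

section Inverse

lemma etaSum_mono {K K' M M' : ℕ} (hK : K ≤ K') (hM : M ≤ M')
    (φ : ℝ × EuclideanSpace ℝ (Fin n) → ℂ) : etaSum K M φ ≤ etaSum K' M' φ := by
  refine (sum_le_sum fun k _ => sum_le_sum_of_subset_of_nonneg
    (range_mono (Nat.succ_le_succ hM)) fun _ _ _ => etaSemi_nonneg _ _ _).trans ?_
  exact sum_le_sum_of_subset_of_nonneg (range_mono (Nat.succ_le_succ hK)) fun _ _ _ =>
    sum_nonneg fun _ _ => etaSemi_nonneg _ _ _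

lemma etaSum_nonneg (K M : ℕ) (φ : ℝ × EuclideanSpace ℝ (Fin n) → ℂ) : 0 ≤ etaSum K M φ :=
  sum_nonneg fun _ _ => sum_nonneg fun _ _ => etaSemi_nonneg _ _ _

section Density

variable {φ : ℝ × EuclideanSpace ℝ (Fin n) → ℂ} {ω : EuclideanSpace ℝ (Fin n)}

lemma IsSH.continuous_fst (h : IsSH φ) (hω : ‖ω‖ = 1) : Continuous fun r : ℝ => φ (r, ω) := by
  have := h.radialClass.continuous_fst (ξ := ω) (norm_ne_zero_iff.1 (by simp [hω]))
  simpa only [density_of_norm_eq_one φ _ hω] using this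

lemma IsSH.integrable (h : IsSH φ) (hω : ‖ω‖ = 1) : Integrable fun r : ℝ => φ (r, ω) := by
  have := h.radialClass.integrable (g := fun _ => 1) (G := 1) (N := 0) continuous_const
    (fun r => by simp) (ξ := ω) (norm_ne_zero_iff.1 (by simp [hω]))
  simpa only [density_of_norm_eq_one φ _ hω, one_smul] using this

lemma IsSH.apply_smul_eq_integral (h : IsSH φ) {F : EuclideanSpace ℝ (Fin n) → ℂ}
    (hF : ∀ ξ, ξ ≠ 0 → F ξ = profileInt (fun r => waveKernel (-1) r) (density φ) ξ)
    (hω : ‖ω‖ = 1) {s : ℝ} (hs : s ≠ 0) :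
    F (s • ω) = ∫ r : ℝ, waveKernel (-s) r * φ (r, ω) := by
  have h0 : ω ≠ 0 := norm_ne_zero_iff.1 (by simp [hω])
  rw [hF _ (smul_ne_zero hs h0)]
  rcases hs.lt_or_gt with hs | hs
  · rw [← neg_smul_neg, profileInt_density φ h.1 (by rwa [norm_neg]) (neg_pos.2 hs),
      ← integral_neg_eq_self]
    refine integral_congr_ae (ae_of_all _ fun r => ?_)
    simp only [h.2.1, waveKernel]
    congr 2
    push_cast
    ring
  · exact profileInt_density φ h.1 hω hs

lemma IsSH.eq_radialWave (h : IsSH φ) {F : 𝓢(EuclideanSpace ℝ (Fin n), ℂ)}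
    (hF : ∀ ξ, ξ ≠ 0 → F ξ = profileInt (fun r => waveKernel (-1) r) (density φ) ξ)
    (hω : ‖ω‖ = 1) (p : ℝ) : φ (p, ω) = radialWave 0 F (p, ω) := by
  have h0 : ω ≠ 0 := norm_ne_zero_iff.1 (by simp [hω])
  have hae : ∀ᵐ s : ℝ, F (s • ω) = ∫ r : ℝ, waveKernel (-s) r * φ (r, ω) := by
    filter_upwards [compl_mem_ae_iff.2 (measure_singleton (0 : ℝ))] with s hs
    exact h.apply_smul_eq_integral hF hω hs
  have hi : Integrable fun s : ℝ => F (s • ω) := by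
    simpa [waveKernel] using integrable_radialWave 0 F (q := (0, ω)) h0
  rw [fourier_inversion_real (h.continuous_fst hω) (h.integrable hω) (hi.congr hae) p, radialWave]
  refine integral_congr_ae ?_
  filter_upwards [hae] with s hs
  simp only [hs, pow_zero, one_mul, smul_eq_mul]

end Density

variable {d : ℕ}

lemma eq_of_radonH_eq {f g : 𝓢(EuclideanSpace ℝ (Fin (d + 1)), ℂ)}
    (h : ∀ (p : ℝ) (ω : EuclideanSpace ℝ (Fin (d + 1))), ‖ω‖ = 1 →
      RadonH f (p, ω) = RadonH g (p, ω)) : f = g := by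
  have h1 (s : ℝ) (ω : EuclideanSpace ℝ (Fin (d + 1))) (hω : ‖ω‖ = 1) :
      (𝓕 f : 𝓢(EuclideanSpace ℝ (Fin (d + 1)), ℂ)) (s • ω) =
        (𝓕 g : 𝓢(EuclideanSpace ℝ (Fin (d + 1)), ℂ)) (s • ω) := by
    refine mul_left_cancel₀ (radonConst_ne_zero d) ?_
    rw [← integral_waveKernel_mul_radonH hω f s, ← integral_waveKernel_mul_radonH hω g s]
    simp only [h _ ω hω]
  have h2 : (𝓕 f : 𝓢(EuclideanSpace ℝ (Fin (d + 1)), ℂ)) = 𝓕 g := by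
    ext ξ
    obtain ⟨ω, hω, hξ⟩ : ∃ ω : EuclideanSpace ℝ (Fin (d + 1)), ‖ω‖ = 1 ∧ ξ = ‖ξ‖ • ω := by
      rcases eq_or_ne ξ 0 with rfl | hξ
      · exact ⟨EuclideanSpace.single 0 1, by simp, by simp⟩
      · have := norm_ne_zero_iff.2 hξ
        exact ⟨‖ξ‖⁻¹ • ξ, by simp [norm_smul, this], by simp [smul_smul, this]⟩
    rw [hξ]
    exact h1 _ ω hω
  simpa using congrArg (fun F : 𝓢(EuclideanSpace ℝ (Fin (d + 1)), ℂ) =>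
    (𝓕⁻ F : 𝓢(EuclideanSpace ℝ (Fin (d + 1)), ℂ))) h2

lemma exists_radonH_eq {φ : ℝ × EuclideanSpace ℝ (Fin (d + 1)) → ℂ} (h : IsSH φ) :
    ∃ f : 𝓢(EuclideanSpace ℝ (Fin (d + 1)), ℂ), ∀ (p : ℝ) (ω : EuclideanSpace ℝ (Fin (d + 1))),
      ‖ω‖ = 1 → RadonH f (p, ω) = φ (p, ω) := by
  obtain ⟨Q, hQ⟩ := h.hasMoments
  obtain ⟨F, hF⟩ := hQ.exists_schwartz h.radialClass
  have hc := radonConst_ne_zero d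
  refine ⟨𝓕⁻ ((radonConst d : ℂ)⁻¹ • F), fun p ω hω => ?_⟩
  rw [radonH_eq_radialWave hω, FourierTransform.fourier_fourierInv_eq, h.eq_radialWave hF hω]
  simp only [radialWave, smul_apply]
  simp only [smul_comm _ (radonConst d : ℂ)⁻¹, integral_smul]
  rw [smul_eq_mul, mul_inv_cancel_left₀ hc]

lemma smul_fourier_eq_profileInt (f : 𝓢(EuclideanSpace ℝ (Fin (d + 1)), ℂ))
    {ξ : EuclideanSpace ℝ (Fin (d + 1))} (hξ : ξ ≠ 0) :
    (radonConst d • 𝓕 f : 𝓢(EuclideanSpace ℝ (Fin (d + 1)), ℂ)) ξ =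
      profileInt (fun r => waveKernel (-1) r) (density (RadonH f)) ξ := by
  have hn : 0 < ‖ξ‖ := norm_pos_iff.2 hξ
  have hω : ‖‖ξ‖⁻¹ • ξ‖ = 1 := by simp [norm_smul, hn.ne']
  have e : ξ = ‖ξ‖ • ‖ξ‖⁻¹ • ξ := by simp [smul_smul, hn.ne']
  rw [e, profileInt_density (RadonH f) (isHomog0_radonH f) hω hn,
    integral_waveKernel_mul_radonH hω, ← e, smul_apply, Complex.real_smul]

lemma exists_seminorm_le_etaSum_radonH (d K M : ℕ) : ∃ C : ℝ, 0 ≤ C ∧ ∃ k m : ℕ,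
    ∀ f : 𝓢(EuclideanSpace ℝ (Fin (d + 1)), ℂ),
      SchwartzMap.seminorm ℝ K M f ≤ C * etaSum k m (RadonH f) := by
  obtain ⟨C₁, hC₁, K', M', h₁⟩ := exists_seminorm_clm_le
    ((radonConst d)⁻¹ • FourierTransform.fourierInvCLM ℝ 𝓢(EuclideanSpace ℝ (Fin (d + 1)), ℂ)) K M
  have hS {K K' M M' : ℕ} (hK : K ≤ K') (hM : M ≤ M')
      (f : 𝓢(EuclideanSpace ℝ (Fin (d + 1)), ℂ)) := etaSum_mono hK hM (RadonH f)
  obtain ⟨C₂, hC₂, k, m, h₂⟩ : ∃ C : ℝ, 0 ≤ C ∧ ∃ k m : ℕ,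
      ∀ f : 𝓢(EuclideanSpace ℝ (Fin (d + 1)), ℂ),
        schwartzSum K' M' (radonConst d • 𝓕 f) ≤ C * etaSum k m (RadonH f) := by
    refine exists_sum_le_mul (S := fun K M (f : 𝓢(EuclideanSpace ℝ (Fin (d + 1)), ℂ)) => etaSum K M (RadonH f)) (range (K' + 1)) hS
      fun k => exists_sum_le_mul (S := fun K M (f : 𝓢(EuclideanSpace ℝ (Fin (d + 1)), ℂ)) => etaSum K M (RadonH f)) (range (M' + 1)) hS
        fun m => ?_
    obtain ⟨C, hC, K, M, h⟩ := exists_seminorm_le_etaSum (Nat.succ_pos d) k m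
    exact ⟨C, hC, K, M, fun f => h _ (isSH_radonH f) _ fun ξ hξ => smul_fourier_eq_profileInt f hξ⟩
  refine ⟨C₁ * C₂, by positivity, k, m, fun f => ?_⟩
  have h := h₁ (radonConst d • 𝓕 f)
  rw [map_smul, smul_apply, smul_smul,
    mul_inv_cancel₀ (radonConst_pos d).ne', one_smul, FourierTransform.fourierInvCLM_apply,
    FourierTransform.fourierInv_fourier_eq] at h
  rw [mul_assoc]
  exact h.trans (mul_le_mul_of_nonneg_left (h₂ f) hC₁)

end Inverse

/-- **Schwartz theorem for the Radon transform.**  The Radon transform is a linear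
topological isomorphism of `𝒮(ℝⁿ)` onto `𝒮_H(Ξ)`: it maps `𝒮(ℝⁿ)` bijectively onto
`𝒮_H(Ξ)` and it and its inverse are continuous for the defining seminorms. -/
theorem stmt1 (n : ℕ) (hn : 2 ≤ n) :
    (∀ f : SchwartzMap (EuclideanSpace ℝ (Fin n)) ℂ, IsSH (RadonH f)) ∧
    (∀ f g : SchwartzMap (EuclideanSpace ℝ (Fin n)) ℂ,
      (∀ (p : ℝ) (ω : EuclideanSpace ℝ (Fin n)), ‖ω‖ = 1 →
        RadonH f (p, ω) = RadonH g (p, ω)) → f = g) ∧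
    (∀ φ : ℝ × EuclideanSpace ℝ (Fin n) → ℂ, IsSH φ →
      ∃ f : SchwartzMap (EuclideanSpace ℝ (Fin n)) ℂ,
        ∀ (p : ℝ) (ω : EuclideanSpace ℝ (Fin n)), ‖ω‖ = 1 →
          RadonH f (p, ω) = φ (p, ω)) ∧
    (∀ k m : ℕ, ∃ C > (0 : ℝ), ∃ K M : ℕ,
      ∀ f : SchwartzMap (EuclideanSpace ℝ (Fin n)) ℂ,
        etaSemi k m (RadonH f) ≤
          C * ∑ k' ∈ Finset.range (K + 1), ∑ m' ∈ Finset.range (M + 1),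
            SchwartzMap.seminorm ℝ k' m' f) ∧
    (∀ K M : ℕ, ∃ C > (0 : ℝ), ∃ k m : ℕ,
      ∀ f : SchwartzMap (EuclideanSpace ℝ (Fin n)) ℂ,
        SchwartzMap.seminorm ℝ K M f ≤
          C * ∑ k' ∈ Finset.range (k + 1), ∑ m' ∈ Finset.range (m + 1),
            etaSemi k' m' (RadonH f)) := by
  obtain ⟨d, rfl⟩ := Nat.exists_eq_add_of_le' (one_le_two.trans hn)
  refine ⟨isSH_radonH, fun f g h => eq_of_radonH_eq h, fun φ h => exists_radonH_eq h,
    fun k m => ?_, fun K M => ?_⟩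
  · obtain ⟨C, hC, K, M, h⟩ := exists_norm_iteratedFDeriv_radonH_le d k m
    refine ⟨C + 1, by positivity, K, M, fun f => ?_⟩
    refine (etaSemi_le (mul_nonneg hC (schwartzSum_nonneg K M f)) (h f)).trans ?_
    exact mul_le_mul_of_nonneg_right (by linarith) (schwartzSum_nonneg K M f)
  · obtain ⟨C, hC, k, m, h⟩ := exists_seminorm_le_etaSum_radonH d K M
    refine ⟨C + 1, by positivity, k, m, fun f => (h f).trans ?_⟩
    exact mul_le_mul_of_nonneg_right (by linarith) (etaSum_nonneg k m _)
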